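/- arXiv:1401.1780 — 11 statements merged into one kernel-verified Lean document; each statement's English description precedes it below -/
import Mathlib

section
/- Let n ≥ 1 and let α₁, …, α_d be vectors in the Euclidean space ℝⁿ. If Σ_{i ≠ j} ⟨αᵢ, αⱼ⟩ · ∏_{k ∉ {i,j}} ⟨αₖ, x⟩ = 0 for all x ∈ ℝⁿ (the sum over all ordered pairs of distinct indices i, j), then the function π⁺(x) = ∏_{i=1}^{d} ⟨αᵢ, x⟩ is harmonic, i.e. Δπ⁺(x) = 0 for all x ∈ ℝⁿ. -/
open scoped RealInnerProductSpace

/-- The Laplacian of `f : ℝⁿ → ℝ`: the sum of second partial derivatives with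
respect to the standard orthonormal basis of `EuclideanSpace ℝ (Fin n)`. -/
noncomputable def laplacian {n : ℕ} (f : EuclideanSpace ℝ (Fin n) → ℝ)
    (x : EuclideanSpace ℝ (Fin n)) : ℝ :=
  ∑ i : Fin n,
    fderiv ℝ (fun y => fderiv ℝ f y (EuclideanSpace.single i 1)) x (EuclideanSpace.single i 1)

theorem hasFDerivAt_prod_inner {ι E : Type*} [DecidableEq ι] [NormedAddCommGroup E]
    [InnerProductSpace ℝ E] (s : Finset ι) (α : ι → E) (x : E) :
    HasFDerivAt (fun y => ∏ i ∈ s, ⟪α i, y⟫)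
      (∑ i ∈ s, (∏ k ∈ s.erase i, ⟪α k, x⟫) • innerSL ℝ (α i)) x :=
  HasFDerivAt.finsetProd (g := fun i y => ⟪α i, y⟫) fun i _ => (innerSL ℝ (α i)).hasFDerivAt

theorem fderiv_prod_inner {ι E : Type*} [DecidableEq ι] [NormedAddCommGroup E]
    [InnerProductSpace ℝ E] (s : Finset ι) (α : ι → E) (x v : E) :
    fderiv ℝ (fun y => ∏ i ∈ s, ⟪α i, y⟫) x v =
      ∑ i ∈ s, ⟪α i, v⟫ * ∏ k ∈ s.erase i, ⟪α k, x⟫ := by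
  simp [(hasFDerivAt_prod_inner s α x).fderiv, mul_comm]

theorem fderiv_fderiv_prod_inner {ι E : Type*} [DecidableEq ι] [NormedAddCommGroup E]
    [InnerProductSpace ℝ E] (s : Finset ι) (α : ι → E) (x v w : E) :
    fderiv ℝ (fun y => fderiv ℝ (fun z => ∏ i ∈ s, ⟪α i, z⟫) y v) x w =
      ∑ i ∈ s, ∑ j ∈ s.erase i,
        ⟪α i, v⟫ * ⟪α j, w⟫ * ∏ k ∈ s \ {i, j}, ⟪α k, x⟫ := by
  have hd (i : ι) : DifferentiableAt ℝ (fun y => ∏ k ∈ s.erase i, ⟪α k, y⟫) x :=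
    (hasFDerivAt_prod_inner _ α x).differentiableAt
  simp_rw [fderiv_prod_inner s α _ v]
  rw [fderiv_fun_sum fun i _ => (hd i).const_mul _, sum_apply]
  refine Finset.sum_congr rfl fun i _ => ?_
  rw [fderiv_const_mul (hd i), smul_apply, fderiv_prod_inner, smul_eq_mul,
    Finset.mul_sum]
  refine Finset.sum_congr rfl fun j _ => ?_
  rw [mul_assoc, Finset.sdiff_insert, Finset.sdiff_singleton_eq_erase, Finset.erase_right_comm]

theorem laplacian_prod_inner {n : ℕ} {ι : Type*} [DecidableEq ι] (s : Finset ι)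
    (α : ι → EuclideanSpace ℝ (Fin n)) (x : EuclideanSpace ℝ (Fin n)) :
    laplacian (fun y => ∏ i ∈ s, ⟪α i, y⟫) x =
      ∑ i ∈ s, ∑ j ∈ s.erase i, ⟪α i, α j⟫ * ∏ k ∈ s \ {i, j}, ⟪α k, x⟫ := by
  simp_rw [laplacian, fderiv_fderiv_prod_inner]
  rw [Finset.sum_comm]
  refine Finset.sum_congr rfl fun i _ => ?_
  rw [Finset.sum_comm]
  refine Finset.sum_congr rfl fun j _ => ?_
  rw [← Finset.sum_mul]
  simp [PiLp.inner_apply, mul_comm]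

theorem harmonic_of_pair_sum_zero {n d : ℕ} (hn : 1 ≤ n)
    (α : Fin d → EuclideanSpace ℝ (Fin n))
    (hsum : ∀ x : EuclideanSpace ℝ (Fin n),
      ∑ i : Fin d, ∑ j ∈ Finset.univ.erase i,
        ⟪α i, α j⟫ * ∏ k ∈ (Finset.univ \ {i, j} : Finset (Fin d)), ⟪α k, x⟫ = 0) :
    ∀ x : EuclideanSpace ℝ (Fin n),
      laplacian (fun y => ∏ i : Fin d, ⟪α i, y⟫) x = 0 := by
  intro x
  rw [laplacian_prod_inner]
  exact hsum x
end

section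
/- Let α and β be vectors in the Euclidean space ℝ² with ⟨α, α⟩ = 2, ⟨β, β⟩ = 2, and ⟨α, β⟩ = −1 (the simple roots of sl₃), and let Φ⁺ = {α, β, α + β} be the set of positive roots. Then for all x ∈ ℝ², Σ ⟨γ, δ⟩ · ∏_{ε ∈ Φ⁺ \ {γ, δ}} ⟨ε, x⟩ = 0, where the sum runs over all ordered pairs (γ, δ) of distinct elements of Φ⁺. -/
open scoped RealInnerProductSpace Classical

/-- The sum over ordered pairs of distinct elements of a three-element set, in which each pair
is weighted by a product over the one remaining element. -/
theorem sum_erase_mul_prod_sdiff_pair {ι R : Type*} [DecidableEq ι] [CommSemiring R]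
    {a b c : ι} (hab : a ≠ b) (hac : a ≠ c) (hbc : b ≠ c) (f : ι → ι → R) (g : ι → R) :
    ∑ i ∈ ({a, b, c} : Finset ι), ∑ j ∈ ({a, b, c} : Finset ι).erase i,
        f i j * ∏ k ∈ ({a, b, c} : Finset ι) \ {i, j}, g k =
      (f a b + f b a) * g c + (f a c + f c a) * g b + (f b c + f c b) * g a := by
  have ea : ({a, b, c} : Finset ι).erase a = {b, c} := by grind
  have eb : ({a, b, c} : Finset ι).erase b = {a, c} := by grind
  have ec : ({a, b, c} : Finset ι).erase c = {a, b} := by grind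
  have dab : ({a, b, c} : Finset ι) \ {a, b} = {c} := by grind
  have dac : ({a, b, c} : Finset ι) \ {a, c} = {b} := by grind
  have dbc : ({a, b, c} : Finset ι) \ {b, c} = {a} := by grind
  rw [Finset.sum_insert (by simp [hab, hac]), Finset.sum_pair hbc, ea, eb, ec,
    Finset.sum_pair hbc, Finset.sum_pair hac, Finset.sum_pair hab,
    Finset.pair_comm b a, Finset.pair_comm c a, Finset.pair_comm c b, dab, dac, dbc]
  simp only [Finset.prod_singleton]
  ring

/-- Vanishing, for the root system of type A₂ (positive roots α, β, α+β), of the sum over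
ordered pairs of distinct positive roots (γ, δ) of ⟪γ, δ⟫ times the product of the linear
forms ⟪ε, ·⟫ over the remaining positive roots. -/
theorem sl3_pair_sum_zero (α β : EuclideanSpace ℝ (Fin 2))
    (hαα : ⟪α, α⟫ = 2) (hββ : ⟪β, β⟫ = 2) (hαβ : ⟪α, β⟫ = -1) :
    ∀ x : EuclideanSpace ℝ (Fin 2),
      ∑ γ ∈ ({α, β, α + β} : Finset (EuclideanSpace ℝ (Fin 2))),
        ∑ δ ∈ ({α, β, α + β} : Finset (EuclideanSpace ℝ (Fin 2))).erase γ,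
          ⟪γ, δ⟫ *
            ∏ ε ∈ ({α, β, α + β} : Finset (EuclideanSpace ℝ (Fin 2))) \ {γ, δ}, ⟪ε, x⟫ = 0 := by
  intro x
  have hβα : ⟪β, α⟫ = -1 := by rw [real_inner_comm, hαβ]
  have hne : α ≠ β := by
    rintro rfl
    linarith
  have hα : α ≠ α + β := by
    intro h
    have hβ0 : β = 0 := by simpa using h
    simp [hβ0] at hββ
  have hβ : β ≠ α + β := by
    intro h
    have hα0 : α = 0 := by simpa using h
    simp [hα0] at hαα
  rw [sum_erase_mul_prod_sdiff_pair hne hα hβ (fun γ δ => ⟪γ, δ⟫) (fun ε => ⟪ε, x⟫)]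
  simp only [inner_add_left, inner_add_right, hαα, hββ, hαβ, hβα]
  ring
end

section
/- Let α and β be vectors in the Euclidean space ℝ² with ⟨α, α⟩ = 1, ⟨β, β⟩ = 2, and ⟨α, β⟩ = −1 (the simple roots of sp₂), and let Φ⁺ = {α, β, α + β, 2α + β} be the set of positive roots. Then for all x ∈ ℝ², Σ ⟨γ, δ⟩ · ∏_{ε ∈ Φ⁺ \ {γ, δ}} ⟨ε, x⟩ = 0, where the sum runs over all ordered pairs (γ, δ) of distinct elements of Φ⁺. -/
open scoped RealInnerProductSpace Classical

/-- Expansion, over a four-element set, of the sum over ordered pairs of distinct elements of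
`g γ δ` times the product of `f` over the two remaining elements. -/
theorem sum_sum_erase_mul_prod_sdiff_pair {ι R : Type*} [DecidableEq ι] [CommRing R]
    (f : ι → R) (g : ι → ι → R) {a b c d : ι}
    (hab : a ≠ b) (hac : a ≠ c) (had : a ≠ d) (hbc : b ≠ c) (hbd : b ≠ d) (hcd : c ≠ d) :
    ∑ γ ∈ ({a, b, c, d} : Finset ι), ∑ δ ∈ ({a, b, c, d} : Finset ι).erase γ,
        g γ δ * ∏ ε ∈ ({a, b, c, d} : Finset ι) \ {γ, δ}, f ε =
      (g a b + g b a) * (f c * f d) + (g a c + g c a) * (f b * f d) +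
      (g a d + g d a) * (f b * f c) + (g b c + g c b) * (f a * f d) +
      (g b d + g d b) * (f a * f c) + (g c d + g d c) * (f a * f b) := by
  simp [Finset.erase_insert_eq_erase, Finset.erase_insert_of_ne, Finset.sdiff_eq_filter,
    Finset.filter_insert, Finset.filter_singleton, hab, hac, had, hbc, hbd, hcd,
    hab.symm, hac.symm, had.symm, hbc.symm, hbd.symm, hcd.symm]
  ring

/-- Vanishing, for the root system of type B₂ = C₂ (positive roots α, β, α+β, 2α+β), of the
sum over ordered pairs of distinct positive roots (γ, δ) of ⟪γ, δ⟫ times the product of the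
linear forms ⟪ε, ·⟫ over the remaining positive roots. -/
theorem sp2_pair_sum_zero (α β : EuclideanSpace ℝ (Fin 2))
    (hαα : ⟪α, α⟫ = 1) (hββ : ⟪β, β⟫ = 2) (hαβ : ⟪α, β⟫ = -1) :
    ∀ x : EuclideanSpace ℝ (Fin 2),
      ∑ γ ∈ ({α, β, α + β, 2 • α + β} : Finset (EuclideanSpace ℝ (Fin 2))),
        ∑ δ ∈ ({α, β, α + β, 2 • α + β} : Finset (EuclideanSpace ℝ (Fin 2))).erase γ,
          ⟪γ, δ⟫ *
            ∏ ε ∈ ({α, β, α + β, 2 • α + β} : Finset (EuclideanSpace ℝ (Fin 2))) \ {γ, δ},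
              ⟪ε, x⟫ = 0 := by
  intro x
  have hβα : ⟪β, α⟫ = -1 := by rw [real_inner_comm, hαβ]
  have hab : α ≠ β := by
    rintro rfl
    linarith
  have hac : α ≠ α + β := fun h => by
    have := congrArg (fun v => ⟪α, v⟫) h
    simp only [inner_add_right] at this
    linarith
  have had : α ≠ 2 • α + β := fun h => by
    have := congrArg (fun v => ⟪β, v⟫) h
    simp only [two_smul, inner_add_right] at this
    linarith
  have hbc : β ≠ α + β := fun h => by
    have := congrArg (fun v => ⟪α, v⟫) h
    simp only [inner_add_right] at this
    linarith
  have hbd : β ≠ 2 • α + β := fun h => by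
    have := congrArg (fun v => ⟪α, v⟫) h
    simp only [two_smul, inner_add_right] at this
    linarith
  have hcd : α + β ≠ 2 • α + β := fun h => by
    have := congrArg (fun v => ⟪α, v⟫) h
    simp only [two_smul, inner_add_right] at this
    linarith
  rw [sum_sum_erase_mul_prod_sdiff_pair (fun ε => ⟪ε, x⟫) (fun γ δ => ⟪γ, δ⟫)
    hab hac had hbc hbd hcd]
  simp only [two_smul, inner_add_left, inner_add_right, hαα, hββ, hαβ, hβα]
  ring
end

section
/- Let α and β be vectors in the Euclidean space ℝ² with ⟨α, α⟩ = 1, ⟨β, β⟩ = 3, and ⟨α, β⟩ = −3/2 (the simple roots of g₂), and let Φ⁺ = {α, β, α + β, 2α + β, 3α + β, 3α + 2β} be the set of positive roots. Then for all x ∈ ℝ², Σ ⟨γ, δ⟩ · ∏_{ε ∈ Φ⁺ \ {γ, δ}} ⟨ε, x⟩ = 0, where the sum runs over all ordered pairs (γ, δ) of distinct elements of Φ⁺. -/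
open scoped RealInnerProductSpace Classical

/-- A sum over ordered pairs of distinct elements of the image of an injective family, weighted by
the product over the remaining elements, is the corresponding sum over indices. -/
theorem sum_offDiag_mul_prod_image {ι E R : Type*} [Fintype ι] [DecidableEq ι] [DecidableEq E]
    [CommSemiring R] {v : ι → E} (hv : Function.Injective v) (B : E → E → R) (f : E → R) :
    ∑ γ ∈ Finset.univ.image v, ∑ δ ∈ (Finset.univ.image v).erase γ,
        B γ δ * ∏ ε ∈ Finset.univ.image v \ {γ, δ}, f ε =
      ∑ i, ∑ j, if j = i then 0 else
        B (v i) (v j) * ∏ k, if k = i ∨ k = j then 1 else f (v k) := by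
  rw [Finset.sum_image hv.injOn]
  refine Finset.sum_congr rfl fun i _ => ?_
  rw [← Finset.image_erase hv, Finset.sum_image hv.injOn, ← Finset.filter_ne',
    Finset.sum_filter]
  refine Finset.sum_congr rfl fun j _ => ?_
  have hpair : ({v i, v j} : Finset E) = ({i, j} : Finset ι).image v := by
    simp [Finset.image_insert]
  rw [hpair, ← Finset.image_sdiff _ _ hv, Finset.prod_image hv.injOn, ite_not]
  congr 2
  rw [← Finset.prod_subset (Finset.subset_univ (Finset.univ \ {i, j}))]
  · exact Finset.prod_congr rfl fun k hk => by simp_all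
  · exact fun k _ hk => by
      rw [if_pos]
      simpa [or_iff_not_imp_left] using hk

/-- Vanishing, for the root system of type G₂ (positive roots α, β, α+β, 2α+β, 3α+β, 3α+2β),
of the sum over ordered pairs of distinct positive roots (γ, δ) of ⟪γ, δ⟫ times the product
of the linear forms ⟪ε, ·⟫ over the remaining positive roots. -/
theorem g2_pair_sum_zero (α β : EuclideanSpace ℝ (Fin 2))
    (hαα : ⟪α, α⟫ = 1) (hββ : ⟪β, β⟫ = 3) (hαβ : ⟪α, β⟫ = -3/2) :
    ∀ x : EuclideanSpace ℝ (Fin 2),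
      ∑ γ ∈ ({α, β, α + β, 2 • α + β, 3 • α + β, 3 • α + 2 • β} :
          Finset (EuclideanSpace ℝ (Fin 2))),
        ∑ δ ∈ ({α, β, α + β, 2 • α + β, 3 • α + β, 3 • α + 2 • β} :
            Finset (EuclideanSpace ℝ (Fin 2))).erase γ,
          ⟪γ, δ⟫ *
            ∏ ε ∈ ({α, β, α + β, 2 • α + β, 3 • α + β, 3 • α + 2 • β} :
                Finset (EuclideanSpace ℝ (Fin 2))) \ {γ, δ},
              ⟪ε, x⟫ = 0 := by
  intro x
  have hβα : ⟪β, α⟫ = -3/2 := by rw [real_inner_comm, hαβ]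
  rw [real_inner_self_eq_norm_sq] at hαα hββ
  have hα : α ≠ 0 := by
    rintro rfl
    simp at hαα
  let v : Fin 6 → EuclideanSpace ℝ (Fin 2) :=
    ![α, β, α + β, 2 • α + β, 3 • α + β, 3 • α + 2 • β]
  have hv : Function.Injective v := by
    have h : Function.Injective fun i => ⟪α, v i⟫ := by
      intro i j hij
      fin_cases i <;> fin_cases j <;>
        first
        | rfl
        | exfalso
          simp only [v, succ_nsmul, zero_nsmul, zero_add] at hij
          norm_num [inner_add_right, hαα, hαβ, hα] at hij
    exact fun i j hij => h (congrArg (fun y => ⟪α, y⟫) hij)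
  have himage : ({α, β, α + β, 2 • α + β, 3 • α + β, 3 • α + 2 • β} :
      Finset (EuclideanSpace ℝ (Fin 2))) = Finset.univ.image v := by
    ext y
    simp [v, Fin.exists_fin_succ, eq_comm]
  rw [himage, sum_offDiag_mul_prod_image hv (fun γ δ => ⟪γ, δ⟫) (fun ε => ⟪ε, x⟫)]
  simp only [Fin.sum_univ_six, Fin.prod_univ_six]
  simp only [v, succ_nsmul, zero_nsmul, zero_add]
  simp [inner_add_left, inner_add_right, hαα, hββ, hαβ, hβα]
  ring
end

section
/- Let Φ be a finite set of nonzero vectors in the Euclidean space ℝⁿ which is a reduced crystallographic root system: Φ = −Φ; for every α ∈ Φ the only scalar multiples of α in Φ are ±α; for all α, β ∈ Φ the number 2⟨α, β⟩/⟨β, β⟩ is an integer; and for all α, β ∈ Φ the reflection s_β(α) = α − (2⟨α, β⟩/⟨β, β⟩)β lies in Φ. Let f : ℝⁿ → ℝ be a linear functional with f(α) ≠ 0 for all α ∈ Φ, and let Φ⁺ = {α ∈ Φ : f(α) > 0} be the corresponding set of positive roots. Then for all x ∈ ℝⁿ, Σ ⟨β, γ⟩ · ∏_{δ ∈ Φ⁺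 \ {β, γ}} ⟨δ, x⟩ = 0, where the sum runs over all ordered pairs (β, γ) of distinct elements of Φ⁺. -/
open scoped RealInnerProductSpace Classical

section PairSum

variable {E : Type*} [NormedAddCommGroup E] [InnerProductSpace ℝ E]

/-- A finite set of nonzero vectors admits a vector orthogonal to none of them. -/
theorem exists_forall_inner_ne_zero (T : Finset E) (hT : (0 : E) ∉ T) :
    ∃ v : E, ∀ a ∈ T, ⟪a, v⟫ ≠ 0 := by
  have h := Subspace.biUnion_ne_univ_of_top_notMem (k := ℝ) (E := E)
    (s := T.image fun a => (ℝ ∙ a)ᗮ) (by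
      intro h
      obtain ⟨a, ha, hat⟩ := Finset.mem_image.mp h
      have : a ∈ (ℝ ∙ a)ᗮ := hat ▸ Submodule.mem_top
      rw [Submodule.mem_orthogonal_singleton_iff_inner_right, inner_self_eq_zero] at this
      exact hT (this ▸ ha))
  obtain ⟨v, hv⟩ := (Set.ne_univ_iff_exists_notMem _).mp h
  refine ⟨v, fun a ha hav => hv ?_⟩
  simp only [Set.mem_iUnion]
  exact ⟨(ℝ ∙ a)ᗮ, Finset.mem_image_of_mem _ ha,
    Submodule.mem_orthogonal_singleton_iff_inner_right.mpr hav⟩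

variable [DecidableEq E]

/-- The sum over the pairs containing a fixed element `d` of a reflection-stable positive set
vanishes on the hyperplane orthogonal to `d`. -/
theorem sum_inner_mul_prod_erase_eq_zero {S : Finset E} (h0 : (0 : E) ∉ S)
    (hpair : ∀ a ∈ S, ∀ b ∈ S, ∀ c : ℝ, b = c • a → b = a)
    (hrefl : ∀ a ∈ S, ∀ b ∈ S, b - (2 * ⟪b, a⟫ / ⟪a, a⟫) • a ∈ S ∨
      -(b - (2 * ⟪b, a⟫ / ⟪a, a⟫) • a) ∈ S)
    {d : E} (hd : d ∈ S) {x : E} (hx : ⟪d, x⟫ = 0) :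
    ∑ γ ∈ S.erase d, ⟪d, γ⟫ * ∏ δ ∈ S \ {d, γ}, ⟪δ, x⟫ = 0 := by
  have hd0 : d ≠ 0 := fun h => h0 (h ▸ hd)
  have hdd : ⟪d, d⟫ ≠ 0 := inner_self_ne_zero.mpr hd0
  have hneg : ∀ a ∈ S, -a ∉ S := fun a ha ha' => by
    have h1 : -a = a := hpair a ha (-a) ha' (-1) (by simp)
    have h2 : a = 0 := by
      have : (2 : ℝ) • a = 0 := by rw [two_smul]; nth_rewrite 1 [← h1]; simp
      simpa using this
    exact h0 (h2 ▸ ha)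
  let s : E → E := fun b => b - (2 * ⟪b, d⟫ / ⟪d, d⟫) • d
  have hs_d : ∀ b, ⟪d, s b⟫ = -⟪d, b⟫ := fun b => by
    simp only [s, inner_sub_right, inner_smul_right, real_inner_comm d b]
    field_simp
    ring
  have hs_x : ∀ b, ⟪s b, x⟫ = ⟪b, x⟫ := fun b => by
    simp [s, inner_sub_left, inner_smul_left, hx]
  have hs_neg : ∀ b, s (-b) = -s b := fun b => by
    simp only [s, inner_neg_left, mul_neg, neg_div, neg_smul]
    abel
  have hs_s : ∀ b, s (s b) = b := fun b => by
    have h := hs_d b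
    rw [real_inner_comm, real_inner_comm b d] at h
    change s b - (2 * ⟪s b, d⟫ / ⟪d, d⟫) • d = b
    rw [h]
    simp only [s, mul_neg, neg_div, neg_smul]
    abel
  have hs_par : ∀ b ∈ S, ∀ c : ℝ, s b = c • d → b = d := fun b hb c h => by
    refine hpair d hd b hb (c + 2 * ⟪b, d⟫ / ⟪d, d⟫) ?_
    rw [add_smul, ← h]
    simp [s]
  have key : ∀ a ∈ S.erase d, ∀ b ∈ S.erase d, ∀ e : ℝ, a ≠ b → ⟪b, x⟫ = e * ⟪a, x⟫ →
      ⟪d, b⟫ = -(e * ⟪d, a⟫) →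
      ⟪d, a⟫ * ∏ δ ∈ S \ {d, a}, ⟪δ, x⟫ + ⟪d, b⟫ * ∏ δ ∈ S \ {d, b}, ⟪δ, x⟫ = 0 := by
    intro a ha b hb e hab h1 h2
    simp only [Finset.mem_erase] at ha hb
    have ea : S \ {d, a} = insert b (S \ {d, a, b}) := by
      ext z
      simp only [Finset.mem_sdiff, Finset.mem_insert, Finset.mem_singleton]
      by_cases hz : z = b
      · subst hz
        tauto
      · tauto
    have eb : S \ {d, b} = insert a (S \ {d, a, b}) := by
      ext z
      simp only [Finset.mem_sdiff, Finset.mem_insert, Finset.mem_singleton]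
      by_cases hz : z = a
      · subst hz
        tauto
      · tauto
    rw [ea, eb, Finset.prod_insert (by simp), Finset.prod_insert (by simp), h1, h2]
    ring
  refine Finset.sum_involution (fun b _ => if s b ∈ S then s b else -s b) ?_ ?_ ?_ ?_
  · intro b hb
    have hb' := Finset.mem_erase.mp hb
    by_cases hsb : s b ∈ S
    · simp only [hsb, if_true]
      by_cases hfix : b = s b
      · have h := hs_d b
        rw [← hfix] at h ⊢
        have : ⟪d, b⟫ = 0 := by linarith
        simp [this]
      · refine key b hb (s b) (Finset.mem_erase.mpr ⟨fun h => hb'.1 ?_, hsb⟩) 1 hfix ?_ ?_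
        · exact hs_par b hb'.2 1 (by simpa using h)
        · simp [hs_x]
        · simp [hs_d]
    · simp only [hsb, if_false]
      have hsb' : -s b ∈ S := (hrefl d hd b hb'.2).resolve_left hsb
      refine key b hb (-s b) (Finset.mem_erase.mpr ⟨fun h => hb'.1 ?_, hsb'⟩) (-1) ?_ ?_ ?_
      · exact hs_par b hb'.2 (-1) (by rw [neg_one_smul, ← h, neg_neg])
      · intro hfix
        refine hb'.1 (hpair d hd b hb'.2 (⟪b, d⟫ / ⟪d, d⟫) ?_)
        have h2 : (2 : ℝ) • b = (2 : ℝ) • ((⟪b, d⟫ / ⟪d, d⟫) • d) := by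
          rw [two_smul, smul_smul, ← mul_div_assoc]
          nth_rewrite 1 [hfix]
          simp [s]
        exact smul_right_injective E (two_ne_zero : (2 : ℝ) ≠ 0) h2
      · simp [hs_x]
      · simp [hs_d]
  · intro b hb hne hfix
    have hb' := Finset.mem_erase.mp hb
    by_cases hsb : s b ∈ S
    · simp only [hsb, if_true] at hfix
      have h := hs_d b
      rw [hfix] at h
      have : ⟪d, b⟫ = 0 := by linarith
      simp [this] at hne
    · simp only [hsb, if_false] at hfix
      refine hb'.1 (hpair d hd b hb'.2 (⟪b, d⟫ / ⟪d, d⟫) ?_)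
      have h2 : (2 : ℝ) • b = (2 : ℝ) • ((⟪b, d⟫ / ⟪d, d⟫) • d) := by
        rw [two_smul, smul_smul, ← mul_div_assoc]
        nth_rewrite 1 [← hfix]
        simp [s]
      exact smul_right_injective E (two_ne_zero : (2 : ℝ) ≠ 0) h2
  · intro b hb
    have hb' := Finset.mem_erase.mp hb
    by_cases hsb : s b ∈ S
    · simp only [hsb, if_true]
      exact Finset.mem_erase.mpr
        ⟨fun h => hb'.1 (hs_par b hb'.2 1 (by simpa using h)), hsb⟩
    · simp only [hsb, if_false]
      exact Finset.mem_erase.mpr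
        ⟨fun h => hb'.1 (hs_par b hb'.2 (-1) (by rw [neg_one_smul, ← h, neg_neg])),
          (hrefl d hd b hb'.2).resolve_left hsb⟩
  · intro b hb
    have hb' := Finset.mem_erase.mp hb
    by_cases hsb : s b ∈ S
    · simp only [hsb, if_true, hs_s, hb'.2]
    · simp only [hsb, if_false, hs_neg, hs_s, hneg b hb'.2, neg_neg]

/-- The pair sum vanishes on every hyperplane orthogonal to an element of the positive set. -/
theorem pair_sum_eq_zero_of_inner_eq_zero {S : Finset E} (h0 : (0 : E) ∉ S)
    (hpair : ∀ a ∈ S, ∀ b ∈ S, ∀ c : ℝ, b = c • a → b = a)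
    (hrefl : ∀ a ∈ S, ∀ b ∈ S, b - (2 * ⟪b, a⟫ / ⟪a, a⟫) • a ∈ S ∨
      -(b - (2 * ⟪b, a⟫ / ⟪a, a⟫) • a) ∈ S)
    {d : E} (hd : d ∈ S) {x : E} (hx : ⟪d, x⟫ = 0) :
    ∑ β ∈ S, ∑ γ ∈ S.erase β, ⟪β, γ⟫ * ∏ δ ∈ S \ {β, γ}, ⟪δ, x⟫ = 0 := by
  have hA := sum_inner_mul_prod_erase_eq_zero h0 hpair hrefl hd hx
  rw [← Finset.add_sum_erase S _ hd, hA, zero_add, ← hA]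
  refine Finset.sum_congr rfl fun β hβ => ?_
  have hβ' := Finset.mem_erase.mp hβ
  rw [Finset.sum_eq_single d, real_inner_comm, Finset.pair_comm]
  · intro γ _ hγd
    rw [Finset.prod_eq_zero (i := d) (by simp [hd, hβ'.1.symm, hγd.symm]) hx, mul_zero]
  · intro h
    exact absurd (Finset.mem_erase.mpr ⟨hβ'.1.symm, hd⟩) h

open Polynomial in
/-- A pair sum vanishing on all hyperplanes orthogonal to elements of `S` vanishes identically,
by a degree count on a generic line. -/
theorem pair_sum_eq_zero {S : Finset E} (h0 : (0 : E) ∉ S)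
    (hpair : ∀ a ∈ S, ∀ b ∈ S, ∀ c : ℝ, b = c • a → b = a)
    (hvanish : ∀ d ∈ S, ∀ x : E, ⟪d, x⟫ = 0 →
      ∑ β ∈ S, ∑ γ ∈ S.erase β, ⟪β, γ⟫ * ∏ δ ∈ S \ {β, γ}, ⟪δ, x⟫ = 0) (x : E) :
    ∑ β ∈ S, ∑ γ ∈ S.erase β, ⟪β, γ⟫ * ∏ δ ∈ S \ {β, γ}, ⟪δ, x⟫ = 0 := by
  by_cases hx : ∃ d ∈ S, ⟪d, x⟫ = 0
  · obtain ⟨d, hd, hdx⟩ := hx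
    exact hvanish d hd x hdx
  push Not at hx
  obtain ⟨v, hv⟩ := exists_forall_inner_ne_zero
    (S ∪ S.offDiag.image fun p => ⟪p.1, x⟫ • p.2 - ⟪p.2, x⟫ • p.1) (by
      simp only [Finset.mem_union, Finset.mem_image, Finset.mem_offDiag, not_or, not_exists,
        not_and]
      refine ⟨h0, fun p hp h => hp.2.2 ?_⟩
      refine (hpair p.1 hp.1 p.2 hp.2.1 (⟪p.2, x⟫ / ⟪p.1, x⟫) ?_).symm
      rw [div_eq_inv_mul, mul_smul, ← sub_eq_zero.mp h, smul_smul,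
        inv_mul_cancel₀ (hx _ hp.1), one_smul])
  have hvS : ∀ d ∈ S, ⟪d, v⟫ ≠ 0 := fun d hd => hv d (Finset.mem_union_left _ hd)
  let q : ℝ[X] := ∑ β ∈ S, ∑ γ ∈ S.erase β,
    C ⟪β, γ⟫ * ∏ δ ∈ S \ {β, γ}, (C ⟪δ, v⟫ * X + C ⟪δ, x⟫)
  have hq_eval : ∀ t : ℝ, q.eval t =
      ∑ β ∈ S, ∑ γ ∈ S.erase β, ⟪β, γ⟫ * ∏ δ ∈ S \ {β, γ}, ⟪δ, x + t • v⟫ := fun t => by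
    simp only [q, eval_finsetSum, eval_mul, eval_C, eval_prod, eval_add, eval_X,
      inner_add_right, inner_smul_right]
    simp only [mul_comm t, add_comm]
  have hq_deg : q.degree < S.card := by
    rw [← mem_degreeLT]
    refine Submodule.sum_mem _ fun β hβ => Submodule.sum_mem _ fun γ hγ => ?_
    rw [mem_degreeLT]
    have hlt : (S \ {β, γ}).card < S.card :=
      Finset.card_lt_card (Finset.ssubset_iff_subset_ne.mpr ⟨Finset.sdiff_subset, fun h => by
        rw [← h] at hβ; simp at hβ⟩)
    refine lt_of_le_of_lt ?_ (Nat.cast_lt.mpr hlt)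
    rw [← smul_eq_C_mul]
    refine (degree_smul_le _ _).trans ((degree_prod_le _ _).trans ?_)
    refine (Finset.sum_le_card_nsmul _ _ 1 fun δ _ => degree_linear_le).trans ?_
    simp
  have hq : q = 0 := by
    refine eq_zero_of_degree_lt_of_eval_index_eq_zero (s := S)
      (v := fun d => -(⟪d, x⟫ / ⟪d, v⟫)) ?_ hq_deg ?_
    · intro a ha b hb hab
      by_contra hne
      refine hv (⟪a, x⟫ • b - ⟪b, x⟫ • a) (Finset.mem_union_right _
        (Finset.mem_image.mpr ⟨(a, b), Finset.mem_offDiag.mpr ⟨ha, hb, hne⟩, rfl⟩)) ?_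
      have h := neg_injective hab
      rw [div_eq_div_iff (hvS a ha) (hvS b hb)] at h
      simp only [inner_sub_left, real_inner_smul_left]
      linarith
    · intro d hd
      rw [hq_eval]
      refine hvanish d hd _ ?_
      have := hvS d hd
      rw [inner_add_right, inner_smul_right]
      field_simp
      ring
  have := hq_eval 0
  rw [hq] at this
  simpa using this.symm

end PairSum

/-- For a reduced crystallographic root system Φ in ℝⁿ with positive system Φ⁺ cut out by a
linear functional `f` nonvanishing on Φ, the sum over ordered pairs (β, γ) of distinct
positive roots of ⟪β, γ⟫ times the product of the linear forms ⟪δ, ·⟫ over the remaining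
positive roots vanishes identically. -/
theorem root_system_pair_sum_zero {n : ℕ} (hn : 1 ≤ n)
    (Φ : Finset (EuclideanSpace ℝ (Fin n)))
    (h0 : (0 : EuclideanSpace ℝ (Fin n)) ∉ Φ)
    (hneg : ∀ a ∈ Φ, -a ∈ Φ)
    (hreduced : ∀ a ∈ Φ, ∀ c : ℝ, c • a ∈ Φ → c = 1 ∨ c = -1)
    (hcrystal : ∀ a ∈ Φ, ∀ b ∈ Φ, ∃ k : ℤ, 2 * ⟪a, b⟫ / ⟪b, b⟫ = (k : ℝ))
    (hrefl : ∀ a ∈ Φ, ∀ b ∈ Φ, a - (2 * ⟪a, b⟫ / ⟪b, b⟫) • b ∈ Φ)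
    (f : EuclideanSpace ℝ (Fin n) →ₗ[ℝ] ℝ) (hf : ∀ a ∈ Φ, f a ≠ 0) :
    ∀ x : EuclideanSpace ℝ (Fin n),
      ∑ β ∈ Φ.filter (fun a => 0 < f a),
        ∑ γ ∈ (Φ.filter (fun a => 0 < f a)).erase β,
          ⟪β, γ⟫ * ∏ δ ∈ Φ.filter (fun a => 0 < f a) \ {β, γ}, ⟪δ, x⟫ = 0 := by
  have hpair : ∀ a ∈ Φ.filter (fun a => 0 < f a), ∀ b ∈ Φ.filter (fun a => 0 < f a),
      ∀ c : ℝ, b = c • a → b = a := by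
    intro a ha b hb c hc
    rw [Finset.mem_filter] at ha hb
    rcases hreduced a ha.1 c (hc ▸ hb.1) with rfl | rfl
    · simpa using hc
    · have h1 := hb.2
      rw [hc, map_smul, smul_eq_mul] at h1
      linarith [ha.2]
  have hzero : (0 : EuclideanSpace ℝ (Fin n)) ∉ Φ.filter (fun a => 0 < f a) :=
    fun h => h0 (Finset.mem_filter.mp h).1
  refine pair_sum_eq_zero hzero hpair fun d hd x hx =>
    pair_sum_eq_zero_of_inner_eq_zero hzero hpair (fun a ha b hb => ?_) hd hx
  have hr := hrefl b (Finset.mem_filter.mp hb).1 a (Finset.mem_filter.mp ha).1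
  rcases lt_or_gt_of_ne (hf _ hr) with h | h
  · exact Or.inr (Finset.mem_filter.mpr ⟨hneg _ hr, by rw [map_neg]; linarith⟩)
  · exact Or.inl (Finset.mem_filter.mpr ⟨hr, h⟩)
end

section
/- Let Φ be a finite reduced crystallographic root system in the Euclidean space ℝⁿ, and let Φ⁺ be a positive system for Φ (the set of roots on which a fixed linear functional, nonvanishing on Φ, is positive). Then the polynomial function π⁺ : ℝⁿ → ℝ defined by π⁺(x) = ∏_{α ∈ Φ⁺} ⟨α, x⟩ is harmonic: Δπ⁺(x) = 0 for all x ∈ ℝⁿ. -/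
open scoped RealInnerProductSpace Classical

/-- The sum `∑ ⟪a, b⟫ ∏ ⟪c, x⟫` over ordered pairs of distinct `a, b ∈ S`, the product being over
the remaining elements of `S`. It is the Laplacian of `∏ a ∈ S, ⟪a, x⟫`. -/
noncomputable def pairSum {E : Type*} [NormedAddCommGroup E] [InnerProductSpace ℝ E]
    [DecidableEq E]
    (S : Finset E) (x : E) : ℝ :=
  ∑ a ∈ S, ∑ b ∈ S.erase a, ⟪a, b⟫ * ∏ c ∈ (S.erase a).erase b, ⟪c, x⟫

section InnerProductSpace

variable {E : Type*} [NormedAddCommGroup E] [InnerProductSpace ℝ E]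

theorem dense_setOf_inner_ne_zero {c : E} (hc : c ≠ 0) : Dense {x : E | ⟪c, x⟫ ≠ 0} := by
  have h : (LinearMap.ker (innerₛₗ ℝ c)) ≠ ⊤ := fun h =>
    hc (inner_self_eq_zero.1 (show c ∈ LinearMap.ker (innerₛₗ ℝ c) from h ▸ Submodule.mem_top))
  refine interior_eq_empty_iff_dense_compl.1 (Set.not_nonempty_iff_eq_empty.1 fun hne => h ?_)
  exact Submodule.eq_top_of_nonempty_interior' _ hne

variable [DecidableEq E]

theorem hasFDerivAt_prod_inner_s6 (S : Finset E) (x : E) :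
    HasFDerivAt (fun y => ∏ a ∈ S, ⟪a, y⟫)
      (∑ a ∈ S, (∏ b ∈ S.erase a, ⟪b, x⟫) • innerSL ℝ a) x :=
  HasFDerivAt.finsetProd fun a _ => (innerSL ℝ a).hasFDerivAt

theorem continuous_pairSum (S : Finset E) : Continuous (pairSum S) := by
  unfold pairSum
  fun_prop

/-- The restriction of `pairSum S` to a line meeting the hyperplanes `a^⊥`, `a ∈ S`, in distinct
points has too many zeros for its degree. -/
theorem pairSum_eq_zero_of_injOn {S : Finset E}
    (hS : ∀ a ∈ S, ∀ y : E, ⟪a, y⟫ = 0 → pairSum S y = 0) {v x : E}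
    (hv : ∀ a ∈ S, ⟪a, v⟫ ≠ 0)
    (hx : Set.InjOn (fun a => ⟪a, x⟫ / ⟪a, v⟫) S) : pairSum S x = 0 := by
  rcases S.eq_empty_or_nonempty with rfl | hne
  · simp [pairSum]
  let Q : Polynomial ℝ := ∑ a ∈ S, ∑ b ∈ S.erase a, Polynomial.C ⟪a, b⟫ *
    ∏ c ∈ (S.erase a).erase b, (Polynomial.C ⟪c, v⟫ * Polynomial.X + Polynomial.C ⟪c, x⟫)
  have hQ (t : ℝ) : Q.eval t = pairSum S (x + t • v) := by
    simp only [Q, pairSum, Polynomial.eval_finsetSum, Polynomial.eval_mul, Polynomial.eval_prod,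
      Polynomial.eval_add, Polynomial.eval_C, Polynomial.eval_X, inner_add_right, inner_smul_right]
    refine Finset.sum_congr rfl fun a _ => Finset.sum_congr rfl fun b _ => ?_
    congr 1
    exact Finset.prod_congr rfl fun c _ => by ring
  have hdeg : Q.natDegree < S.card := by
    refine lt_of_le_of_lt (b := S.card - 1) ?_ (Nat.sub_lt hne.card_pos one_pos)
    refine Polynomial.natDegree_sum_le_of_forall_le _ _ fun a ha =>
      Polynomial.natDegree_sum_le_of_forall_le _ _ fun b _ => ?_
    refine (Polynomial.natDegree_C_mul_le _ _).trans ((Polynomial.natDegree_prod_le _ _).trans ?_)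
    refine (Finset.sum_le_card_nsmul _ _ 1 fun c _ => Polynomial.natDegree_linear_le).trans ?_
    rw [smul_eq_mul, mul_one, ← Finset.card_erase_of_mem ha]
    exact Finset.card_le_card (Finset.erase_subset _ _)
  have hQ0 : Q = 0 := by
    refine Polynomial.eq_zero_of_natDegree_lt_card_of_eval_eq_zero' Q
      (S.image fun a => -(⟪a, x⟫ / ⟪a, v⟫)) ?_ ?_
    · intro t ht
      obtain ⟨a, ha, rfl⟩ := Finset.mem_image.1 ht
      rw [hQ]
      refine hS a ha _ ?_
      have := hv a ha
      rw [inner_add_right, inner_smul_right]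
      field_simp
      ring
    · rwa [Finset.card_image_of_injOn fun a ha b hb hab => hx ha hb (neg_injective hab)]
  simpa [hQ0] using (hQ 0).symm

/-- If `pairSum S` vanishes on the hyperplanes orthogonal to the pairwise non-proportional vectors
in `S`, then it vanishes identically. -/
theorem pairSum_eq_zero [CompleteSpace E] {S : Finset E}
    (hS : ∀ a ∈ S, ∀ y : E, ⟪a, y⟫ = 0 → pairSum S y = 0) {v : E}
    (hv : ∀ a ∈ S, ⟪a, v⟫ ≠ 0)
    (hprop : ∀ a ∈ S, ∀ b ∈ S, a ≠ b → ⟪b, v⟫ • a - ⟪a, v⟫ • b ≠ 0) (x : E) :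
    pairSum S x = 0 := by
  have hdense : Dense (⋂ p ∈ S.offDiag, {y : E | ⟪⟪p.2, v⟫ • p.1 - ⟪p.1, v⟫ • p.2, y⟫ ≠ 0}) := by
    refine dense_biInter_of_isOpen (S := (S.offDiag : Set (E × E)))
      (fun p _ => isOpen_ne_fun (by fun_prop) continuous_const) S.offDiag.countable_toSet
      fun p hp => ?_
    obtain ⟨h1, h2, h3⟩ := Finset.mem_offDiag.1 hp
    exact dense_setOf_inner_ne_zero (hprop _ h1 _ h2 h3)
  have hzero := (continuous_pairSum S).ext_on hdense (continuous_const (y := (0 : ℝ))) fun y hy => by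
    refine pairSum_eq_zero_of_injOn hS hv fun a ha b hb hab => ?_
    by_contra hne
    refine Set.mem_iInter₂.1 hy (a, b) (Finset.mem_offDiag.2 ⟨ha, hb, hne⟩) ?_
    have := (div_eq_div_iff (hv a ha) (hv b hb)).1 hab
    simp only [inner_sub_left, real_inner_smul_left]
    linarith
  exact congrFun hzero x

/-- On the hyperplane orthogonal to `a ∈ S`, only the pairs involving `a` contribute. -/
theorem pairSum_of_inner_eq_zero {S : Finset E} {a x : E} (ha : a ∈ S) (hx : ⟪a, x⟫ = 0) :
    pairSum S x = 2 * ∑ b ∈ S.erase a, ⟪a, b⟫ * ∏ c ∈ (S.erase a).erase b, ⟪c, x⟫ := by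
  rw [pairSum, ← Finset.add_sum_erase _ _ ha, two_mul]
  congr 1
  refine Finset.sum_congr rfl fun b hb => ?_
  obtain ⟨hba, hb⟩ := Finset.mem_erase.1 hb
  rw [Finset.sum_eq_single_of_mem a (Finset.mem_erase.2 ⟨hba.symm, ha⟩), real_inner_comm,
    Finset.erase_right_comm]
  intro c _ hca
  rw [Finset.prod_eq_zero (i := a) (by simp [ha, hba.symm, hca.symm]) hx, mul_zero]

/-- Terms indexed by `b` and by `b' = ± s_a b` cancel on the hyperplane orthogonal to `a`. -/
theorem sum_inner_mul_prod_eq_zero {T : Finset E} {a x : E} (g : E → E)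
    (hmem : ∀ b ∈ T, g b ∈ T) (hinv : ∀ b ∈ T, g (g b) = b)
    (hfix : ∀ b ∈ T, g b = b → ⟪a, b⟫ = 0)
    (hsign : ∀ b ∈ T, ∃ ε : ℝ, ⟪g b, x⟫ = ε * ⟪b, x⟫ ∧ ⟪a, g b⟫ = -(ε * ⟪a, b⟫)) :
    ∑ b ∈ T, ⟪a, b⟫ * ∏ c ∈ T.erase b, ⟪c, x⟫ = 0 := by
  refine Finset.sum_involution (fun b _ => g b) (fun b hb => ?_)
    (fun b hb hne h => hne (by rw [hfix b hb h, zero_mul])) hmem hinv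
  by_cases h : g b = b
  · rw [h, hfix b hb h]; simp
  · obtain ⟨ε, h1, h2⟩ := hsign b hb
    rw [← Finset.mul_prod_erase (T.erase b) _ (Finset.mem_erase.2 ⟨h, hmem b hb⟩),
      ← Finset.mul_prod_erase (T.erase (g b)) _ (Finset.mem_erase.2 ⟨Ne.symm h, hb⟩),
      Finset.erase_right_comm, h1, h2]
    ring

/-- For the positive roots, `pairSum` vanishes on every root hyperplane. -/
theorem pairSum_posRoots_eq_zero {Φ : Finset E} (h0 : (0 : E) ∉ Φ)
    (hneg : ∀ a ∈ Φ, -a ∈ Φ)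
    (hreduced : ∀ a ∈ Φ, ∀ c : ℝ, c • a ∈ Φ → c = 1 ∨ c = -1)
    (hrefl : ∀ a ∈ Φ, ∀ b ∈ Φ, a - (2 * ⟪a, b⟫ / ⟪b, b⟫) • b ∈ Φ)
    (f : E →ₗ[ℝ] ℝ) (hf : ∀ a ∈ Φ, f a ≠ 0) {a x : E}
    (ha : a ∈ Φ.filter (fun a => 0 < f a)) (hx : ⟪a, x⟫ = 0) :
    pairSum (Φ.filter (fun a => 0 < f a)) x = 0 := by
  rw [pairSum_of_inner_eq_zero ha hx]
  obtain ⟨haΦ, hfa⟩ := Finset.mem_filter.1 ha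
  have haa : ⟪a, a⟫ ≠ 0 := fun h => h0 (inner_self_eq_zero.1 h ▸ haΦ)
  let s : E → E := fun b => b - (2 * ⟪b, a⟫ / ⟪a, a⟫) • a
  have hs_neg (b : E) : s (-b) = -s b := by
    simp only [s, inner_neg_left]; module
  have hs_a (b : E) : ⟪s b, a⟫ = -⟪b, a⟫ := by
    simp only [s, inner_sub_left, real_inner_smul_left]; field_simp; ring
  have hs_x (b : E) : ⟪s b, x⟫ = ⟪b, x⟫ := by
    simp only [s, inner_sub_left, real_inner_smul_left, hx]; ring
  have hs_s (b : E) : s (s b) = b := by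
    change s b - (2 * ⟪s b, a⟫ / ⟪a, a⟫) • a = b
    rw [hs_a]; simp only [s]; module
  have hs_self : s a = -a := by
    simp only [s]; rw [mul_div_assoc, div_self haa]; module
  let g : E → E := fun b => if 0 < f (s b) then s b else -s b
  have hg (b : E) : g b = s b ∨ g b = -s b := by
    simp only [g]; split_ifs <;> simp
  have hmemΦ : ∀ b ∈ Φ.filter (fun a => 0 < f a), g b ∈ Φ.filter (fun a => 0 < f a) := by
    intro b hb
    have hsb := hrefl b (Finset.mem_filter.1 hb).1 a haΦ
    simp only [g]
    split_ifs with h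
    · exact Finset.mem_filter.2 ⟨hsb, h⟩
    · refine Finset.mem_filter.2 ⟨hneg _ hsb, ?_⟩
      rw [map_neg, neg_pos]
      exact lt_of_le_of_ne (not_lt.1 h) (hf _ hsb)
  have hginv : ∀ b ∈ Φ.filter (fun a => 0 < f a), g (g b) = b := by
    intro b hb
    have hfb := (Finset.mem_filter.1 hb).2
    rcases hg b with h | h
    · rw [h]; simp only [g, hs_s, if_pos hfb]
    · rw [h]; simp only [g, hs_neg, hs_s, map_neg, neg_pos, if_neg hfb.not_gt, neg_neg]
  have hga : g a = a := by
    simp only [g, hs_self, map_neg, neg_pos, if_neg hfa.not_gt, neg_neg]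
  rw [sum_inner_mul_prod_eq_zero g, mul_zero]
  · intro b hb
    obtain ⟨hba, hb⟩ := Finset.mem_erase.1 hb
    exact Finset.mem_erase.2
      ⟨fun h => hba (by rw [← hginv b hb, h, hga]), hmemΦ b hb⟩
  · exact fun b hb => hginv b (Finset.mem_of_mem_erase hb)
  · intro b hb hgb
    obtain ⟨hba, hb⟩ := Finset.mem_erase.1 hb
    obtain ⟨hbΦ, hfb⟩ := Finset.mem_filter.1 hb
    rcases hg b with h | h
    · have := hs_a b
      rw [← h, hgb] at this
      rw [real_inner_comm]
      linarith
    · exfalso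
      have hb' : b = (⟪b, a⟫ / ⟪a, a⟫) • a := by
        have h2 : (2 : ℝ) • b = (2 * ⟪b, a⟫ / ⟪a, a⟫) • a := by
          have h3 : b = -(b - (2 * ⟪b, a⟫ / ⟪a, a⟫) • a) := hgb.symm.trans h
          rw [two_smul]
          nth_rewrite 1 [h3]
          abel
        rw [mul_div_assoc, mul_smul] at h2
        exact smul_right_injective E (two_ne_zero (α := ℝ)) h2
      rcases hreduced a haΦ _ (hb' ▸ hbΦ) with h1 | h1
      · rw [h1, one_smul] at hb'
        exact hba hb'
      · rw [h1, neg_one_smul] at hb'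
        rw [hb', map_neg] at hfb
        linarith
  · intro b _
    rcases hg b with h | h
    · exact ⟨1, by rw [h, hs_x, one_mul], by rw [h, real_inner_comm, hs_a, real_inner_comm, one_mul]⟩
    · exact ⟨-1, by rw [h, inner_neg_left, hs_x]; ring,
        by rw [h, inner_neg_right, real_inner_comm, hs_a, real_inner_comm]; ring⟩

end InnerProductSpace

theorem laplacian_prod_inner_s6 {n : ℕ} (S : Finset (EuclideanSpace ℝ (Fin n)))
    (x : EuclideanSpace ℝ (Fin n)) :
    laplacian (fun y => ∏ a ∈ S, ⟪a, y⟫) x = pairSum S x := by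
  have h1 (i : Fin n) : (fun y => fderiv ℝ (fun y => ∏ a ∈ S, ⟪a, y⟫) y
      (EuclideanSpace.single i 1)) = fun y => ∑ a ∈ S, (∏ b ∈ S.erase a, ⟪b, y⟫) * a i := by
    ext y
    simp [(hasFDerivAt_prod_inner_s6 S y).fderiv, EuclideanSpace.inner_single_right]
  have h2 (i : Fin n) : fderiv ℝ (fun y => ∑ a ∈ S, (∏ b ∈ S.erase a, ⟪b, y⟫) * a i) x
      (EuclideanSpace.single i 1) =
      ∑ a ∈ S, ∑ b ∈ S.erase a, a i * b i * ∏ c ∈ (S.erase a).erase b, ⟪c, x⟫ := by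
    rw [(HasFDerivAt.fun_sum fun a _ =>
      (hasFDerivAt_prod_inner_s6 (S.erase a) x).mul_const (a i)).fderiv]
    simp only [_root_.sum_apply, _root_.smul_apply, smul_eq_mul,
      innerSL_apply_apply, EuclideanSpace.inner_single_right, Finset.mul_sum]
    refine Finset.sum_congr rfl fun a _ => Finset.sum_congr rfl fun b _ => ?_
    simp
    ring
  simp only [laplacian, h1, h2, pairSum]
  rw [Finset.sum_comm]
  refine Finset.sum_congr rfl fun a _ => ?_
  rw [Finset.sum_comm]
  refine Finset.sum_congr rfl fun b _ => ?_
  rw [← Finset.sum_mul, PiLp.inner_apply]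
  simp [mul_comm]

/-- For a reduced crystallographic root system Φ in ℝⁿ with positive system Φ⁺ cut out by a
linear functional `f` nonvanishing on Φ, the polynomial π⁺(x) = ∏_{α ∈ Φ⁺} ⟪α, x⟫
is harmonic. -/
theorem piPlus_harmonic {n : ℕ} (hn : 1 ≤ n)
    (Φ : Finset (EuclideanSpace ℝ (Fin n)))
    (h0 : (0 : EuclideanSpace ℝ (Fin n)) ∉ Φ)
    (hneg : ∀ a ∈ Φ, -a ∈ Φ)
    (hreduced : ∀ a ∈ Φ, ∀ c : ℝ, c • a ∈ Φ → c = 1 ∨ c = -1)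
    (hcrystal : ∀ a ∈ Φ, ∀ b ∈ Φ, ∃ k : ℤ, 2 * ⟪a, b⟫ / ⟪b, b⟫ = (k : ℝ))
    (hrefl : ∀ a ∈ Φ, ∀ b ∈ Φ, a - (2 * ⟪a, b⟫ / ⟪b, b⟫) • b ∈ Φ)
    (f : EuclideanSpace ℝ (Fin n) →ₗ[ℝ] ℝ) (hf : ∀ a ∈ Φ, f a ≠ 0) :
    ∀ x : EuclideanSpace ℝ (Fin n),
      laplacian (fun y => ∏ a ∈ Φ.filter (fun a => 0 < f a), ⟪a, y⟫) x = 0 := by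
  intro x
  rw [laplacian_prod_inner_s6]
  obtain ⟨v, hv⟩ : ∃ v, ∀ a, ⟪a, v⟫ = f a :=
    ⟨(InnerProductSpace.toDual ℝ _).symm (LinearMap.toContinuousLinearMap f), fun a => by
      rw [real_inner_comm, InnerProductSpace.toDual_symm_apply]; rfl⟩
  refine pairSum_eq_zero
    (fun a ha y hy => pairSum_posRoots_eq_zero h0 hneg hreduced hrefl f hf ha hy) (v := v)
    (fun a ha => ?_) (fun a ha b hb hab h => ?_) x
  · rw [hv]
    exact (Finset.mem_filter.1 ha).2.ne'
  · obtain ⟨haΦ, hfa⟩ := Finset.mem_filter.1 ha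
    obtain ⟨hbΦ, hfb⟩ := Finset.mem_filter.1 hb
    rw [hv, hv, sub_eq_zero] at h
    have hb' : b = (f b / f a) • a := by
      rw [div_eq_inv_mul, mul_smul, h, smul_smul, inv_mul_cancel₀ hfa.ne', one_smul]
    rcases hreduced a haΦ _ (hb' ▸ hbΦ) with h1 | h1
    · rw [h1, one_smul] at hb'
      exact hab hb'.symm
    · linarith [div_pos hfb hfa]
end

section
/- Let n ≥ 1 be an odd integer, let z ∈ ℂ with Re(z) > 0, and let x ∈ ℝⁿ. Then ∫_{ℝⁿ} e^{i⟨ξ, x⟩} / (‖ξ‖² + z²)^{(n+1)/2} dξ = (π^{(n+1)/2} / ((n−1)/2)!) · e^{−‖x‖ z} / z. -/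
open scoped RealInnerProductSpace
open Real MeasureTheory

theorem integrableOn_pow_mul_cexp_neg_mul (k : ℕ) {w : ℂ} (hw : 0 < w.re) :
    IntegrableOn (fun t : ℝ ↦ (t : ℂ) ^ k * Complex.exp (-w * t)) (Set.Ioi 0) := by
  have h := integrableOn_rpow_mul_exp_neg_mul_rpow (s := k) (p := 1) (b := w.re)
    (by linarith [k.cast_nonneg (α := ℝ)]) one_pos hw
  refine Integrable.mono' h (by fun_prop) ?_
  filter_upwards [ae_restrict_mem measurableSet_Ioi] with t ht
  simp [Complex.norm_exp, abs_of_pos (Set.mem_Ioi.1 ht)]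

theorem integral_pow_mul_cexp_neg_mul_Ioi (k : ℕ) {w : ℂ} (hw : 0 < w.re) :
    ∫ t in Set.Ioi (0 : ℝ), (t : ℂ) ^ k * Complex.exp (-w * t) = k.factorial / w ^ (k + 1) := by
  have hw0 : w ≠ 0 := by rintro rfl; simp at hw
  induction k with
  | zero =>
    simp only [pow_zero, one_mul]
    rw [integral_exp_mul_complex_Ioi (by simpa using hw)]
    simp [neg_div_neg_eq]
  | succ k ih =>
    have h0 := integrableOn_pow_mul_cexp_neg_mul k hw
    have h1 := integrableOn_pow_mul_cexp_neg_mul (k + 1) hw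
    have hd (t : ℝ) : HasDerivAt (fun t : ℝ ↦ (t : ℂ) ^ (k + 1) * Complex.exp (-w * t))
        ((k + 1) * ((t : ℂ) ^ k * Complex.exp (-w * t)) -
          w * ((t : ℂ) ^ (k + 1) * Complex.exp (-w * t))) t := by
      have ht : HasDerivAt (fun t : ℝ ↦ (t : ℂ)) 1 t := Complex.ofRealCLM.hasDerivAt
      refine ((ht.pow (k + 1)).mul (ht.const_mul (-w)).cexp).congr_deriv ?_
      rw [Nat.add_sub_cancel, Pi.pow_apply]
      push_cast
      ring
    have hi := (h0.const_mul ((k : ℂ) + 1)).sub (h1.const_mul w)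
    have hl := tendsto_zero_of_hasDerivAt_of_integrableOn_Ioi (fun t _ ↦ hd t) hi h1
    have he := integral_Ioi_of_hasDerivAt_of_tendsto' (fun t _ ↦ hd t) hi hl
    rw [integral_sub (h0.const_mul _) (h1.const_mul _), integral_const_mul, integral_const_mul,
      ih] at he
    simp only [Complex.ofReal_zero, ne_eq, Nat.add_eq_zero_iff, one_ne_zero, and_false,
      not_false_eq_true, zero_pow, zero_mul, sub_zero] at he
    rw [eq_div_iff (pow_ne_zero _ hw0), Nat.factorial_succ]
    push_cast
    have hd : (k.factorial : ℂ) / w ^ (k + 1) * w ^ (k + 1) = k.factorial :=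
      div_mul_cancel₀ _ (pow_ne_zero _ hw0)
    linear_combination -w ^ (k + 1) * he + (k + 1) * hd

section Euclidean

variable {V : Type*} [NormedAddCommGroup V] [InnerProductSpace ℝ V] [FiniteDimensional ℝ V]
  [MeasurableSpace V] [BorelSpace V]

theorem integrable_inv_mul_norm_sq_add_pow {k : ℕ} (hk : Module.finrank ℝ V < 2 * k) {a b : ℝ}
    (ha : 0 < a) (hb : 0 < b) : Integrable (fun v : V ↦ ((a * ‖v‖ ^ 2 + b) ^ k)⁻¹) := by
  have h := integrable_rpow_neg_one_add_norm_sq (E := V) (μ := volume) (r := 2 * k)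
    (by exact_mod_cast hk)
  have hm : 0 < min a b := lt_min ha hb
  refine Integrable.mono' (h.const_mul ((min a b ^ k)⁻¹)) (by fun_prop) (.of_forall fun v ↦ ?_)
  have hpos : 0 < a * ‖v‖ ^ 2 + b := by positivity
  rw [norm_of_nonneg (by positivity), show (-(2 * k : ℝ) / 2) = -(k : ℝ) by ring,
    rpow_neg (by positivity), rpow_natCast, ← mul_inv, ← mul_pow]
  gcongr
  nlinarith [min_le_right a b,
    mul_le_mul_of_nonneg_right (min_le_left a b) (sq_nonneg ‖v‖)]

theorem integrable_pow_mul_cexp_prod {k : ℕ} (hk : Module.finrank ℝ V < 2 * (k + 1)) {c d : ℂ}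
    (hc : 0 < c.re) (hd : 0 < d.re) (x : V) :
    Integrable (fun p : V × ℝ ↦ (p.2 : ℂ) ^ k * Complex.exp (-(c * ‖p.1‖ ^ 2 + d) * p.2) *
      Complex.exp (Complex.I * (⟪p.1, x⟫ : ℝ)))
      ((volume : Measure V).prod (volume.restrict (Set.Ioi (0 : ℝ)))) := by
  have hre (v : V) : (c * ‖v‖ ^ 2 + d).re = c.re * ‖v‖ ^ 2 + d.re := by
    simp [← Complex.ofReal_pow]
  have hpos (v : V) : 0 < c.re * ‖v‖ ^ 2 + d.re := by positivity
  rw [integrable_prod_iff (Continuous.aestronglyMeasurable (by fun_prop))]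
  refine ⟨.of_forall fun v ↦ ?_, ?_⟩
  · have hw : 0 < (c * ‖v‖ ^ 2 + d).re := by rw [hre]; exact hpos v
    exact Integrable.mul_const (integrableOn_pow_mul_cexp_neg_mul k hw)
      (Complex.exp (Complex.I * (⟪v, x⟫ : ℝ)))
  · refine ((integrable_inv_mul_norm_sq_add_pow hk hc hd).const_mul (k.factorial : ℝ)).congr
      (.of_forall fun v ↦ ?_)
    have h := integral_pow_mul_cexp_neg_mul_Ioi k (w := ((c.re * ‖v‖ ^ 2 + d.re : ℝ) : ℂ))
      (by simpa only [Complex.ofReal_re] using hpos v)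
    apply Complex.ofReal_injective
    rw [← integral_complex_ofReal]
    push_cast at h ⊢
    rw [← div_eq_mul_inv, ← h]
    refine setIntegral_congr_fun measurableSet_Ioi fun t ht ↦ ?_
    have ht' : 0 < t := ht
    simp [Complex.norm_exp, abs_of_pos ht', -neg_add_rev, ← Complex.ofReal_pow]

theorem integral_cexp_inner_div_norm_sq_add_pow {k : ℕ} (hk : Module.finrank ℝ V = 2 * k + 1)
    {c z : ℂ} (hc : 0 < c.re) (hcz : 0 < (c * z ^ 2).re) (x : V) :
    ∫ v : V, Complex.exp (Complex.I * (⟪v, x⟫ : ℝ)) / ((‖v‖ : ℂ) ^ 2 + z ^ 2) ^ (k + 1) =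
      (π : ℂ) ^ k / k.factorial * ∫ t in Set.Ioi (0 : ℝ), c * Complex.exp (-(c * z ^ 2) * t) *
        ((π / (c * t)) ^ (1 / 2 : ℂ) * Complex.exp (-‖x‖ ^ 2 / (4 * (c * t)))) := by
  have hc0 : c ≠ 0 := by rintro rfl; simp at hc
  have hre (v : V) : 0 < (c * ‖v‖ ^ 2 + c * z ^ 2).re := by
    have : (c * ‖v‖ ^ 2 + c * z ^ 2).re = c.re * ‖v‖ ^ 2 + (c * z ^ 2).re := by
      simp [← Complex.ofReal_pow]
    rw [this]
    positivity
  have hkf : (k.factorial : ℂ) ≠ 0 := by exact_mod_cast k.factorial_ne_zero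
  calc
    _ = ∫ v : V, c ^ (k + 1) / k.factorial * ∫ t in Set.Ioi (0 : ℝ),
          (t : ℂ) ^ k * Complex.exp (-(c * ‖v‖ ^ 2 + c * z ^ 2) * t) *
          Complex.exp (Complex.I * (⟪v, x⟫ : ℝ)) := by
      congr 1 with v
      rw [integral_mul_const, integral_pow_mul_cexp_neg_mul_Ioi k (hre v), ← mul_add, mul_pow]
      have : (‖v‖ : ℂ) ^ 2 + z ^ 2 ≠ 0 := by
        intro h
        have := hre v
        simp [← mul_add, h] at this
      field_simp
    _ = c ^ (k + 1) / k.factorial * ∫ t in Set.Ioi (0 : ℝ), ∫ v : V,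
          (t : ℂ) ^ k * Complex.exp (-(c * ‖v‖ ^ 2 + c * z ^ 2) * t) *
          Complex.exp (Complex.I * (⟪v, x⟫ : ℝ)) := by
      rw [integral_const_mul,
        integral_integral_swap (integrable_pow_mul_cexp_prod (by omega) hc hcz x)]
    _ = _ := by
      rw [← integral_const_mul, ← integral_const_mul]
      refine setIntegral_congr_fun measurableSet_Ioi fun t ht ↦ ?_
      have ht' : 0 < t := ht
      have ht0 : (t : ℂ) ≠ 0 := by exact_mod_cast ht'.ne'
      have hct : 0 < (c * t).re := by simpa using mul_pos hc ht'
      have hpi : (π : ℂ) / (c * t) ≠ 0 :=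
        div_ne_zero (by exact_mod_cast pi_ne_zero) (mul_ne_zero hc0 ht0)
      have hg := GaussianFourier.integral_cexp_neg_mul_sq_norm_add hct Complex.I x
      have hs (v : V) : (t : ℂ) ^ k * Complex.exp (-(c * ‖v‖ ^ 2 + c * z ^ 2) * t) *
          Complex.exp (Complex.I * (⟪v, x⟫ : ℝ)) =
          (t : ℂ) ^ k * Complex.exp (-(c * z ^ 2) * t) *
          Complex.exp (-(c * t) * ‖v‖ ^ 2 + Complex.I * (⟪x, v⟫ : ℝ)) := by
        rw [mul_assoc, mul_assoc, ← Complex.exp_add, ← Complex.exp_add, real_inner_comm]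
        ring_nf
      simp only [hs]
      rw [integral_const_mul, hg, hk, show ((2 * k + 1 : ℕ) : ℂ) / 2 = k + 1 / 2 by
        push_cast; ring, Complex.cpow_add _ _ hpi, Complex.cpow_natCast, Complex.I_sq, div_pow,
        mul_pow, neg_one_mul]
      field_simp
      ring

end Euclidean

theorem re_conj_mul_sq_pos {z : ℂ} (hz : 0 < z.re) : 0 < ((starRingEnd ℂ) z * z ^ 2).re := by
  rw [pow_two, ← mul_assoc, mul_comm ((starRingEnd ℂ) z) z, Complex.mul_conj,
    Complex.re_ofReal_mul]
  exact mul_pos (Complex.normSq_pos.2 (by rintro rfl; simp at hz)) hz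

theorem integrable_inv_sq_add_sq {z : ℂ} (hz : 0 < z.re) :
    Integrable (fun s : ℝ ↦ ((s : ℂ) ^ 2 + z ^ 2)⁻¹) := by
  have h := integrable_inv_mul_norm_sq_add_pow (V := ℝ) (k := 1) (by simp) hz
    (re_conj_mul_sq_pos hz)
  refine Integrable.mono' (h.const_mul ‖z‖) (by fun_prop) (.of_forall fun s ↦ ?_)
  have hpos : 0 < z.re * ‖s‖ ^ 2 + ((starRingEnd ℂ) z * z ^ 2).re :=
    add_pos_of_nonneg_of_pos (by positivity) (re_conj_mul_sq_pos hz)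
  have hle : z.re * ‖s‖ ^ 2 + ((starRingEnd ℂ) z * z ^ 2).re ≤ ‖z‖ * ‖(s : ℂ) ^ 2 + z ^ 2‖ := by
    refine le_of_eq_of_le ?_ (((starRingEnd ℂ) z * ((s : ℂ) ^ 2 + z ^ 2)).re_le_norm.trans_eq ?_)
    · rw [mul_add, Complex.add_re, ← Complex.ofReal_pow, Complex.re_mul_ofReal, Complex.conj_re,
        Real.norm_eq_abs, sq_abs]
    · rw [norm_mul, RCLike.norm_conj]
  have hs : 0 < ‖(s : ℂ) ^ 2 + z ^ 2‖ :=
    pos_of_mul_pos_right (hpos.trans_le hle) (norm_nonneg z)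
  rw [pow_one, norm_inv, ← div_eq_mul_inv, le_div_iff₀ hpos, inv_mul_le_iff₀ hs, mul_comm _ ‖z‖]
  exact hle

theorem integrable_and_integral_cexp_neg_mul_abs_add {z a : ℂ} (hz : |a.re| < z.re) :
    Integrable (fun x : ℝ ↦ Complex.exp (-z * |x| + a * x)) ∧
      ∫ x : ℝ, Complex.exp (-z * |x| + a * x) = (z + a)⁻¹ + (z - a)⁻¹ := by
  obtain ⟨h₁, h₂⟩ := abs_lt.1 hz
  have hp : 0 < (z + a).re := by rw [Complex.add_re]; linarith
  have hn : (a - z).re < 0 := by rw [Complex.sub_re]; linarith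
  have hIic : Set.EqOn (fun x : ℝ ↦ Complex.exp ((z + a) * x))
      (fun x : ℝ ↦ Complex.exp (-z * |x| + a * x)) (Set.Iic 0) := fun x hx ↦ by
    simp only [abs_of_nonpos (Set.mem_Iic.1 hx), Complex.ofReal_neg]
    ring_nf
  have hIoi : Set.EqOn (fun x : ℝ ↦ Complex.exp ((a - z) * x))
      (fun x : ℝ ↦ Complex.exp (-z * |x| + a * x)) (Set.Ioi 0) := fun x hx ↦ by
    simp only [abs_of_pos (Set.mem_Ioi.1 hx)]
    ring_nf
  have iIic := (integrableOn_exp_mul_complex_Iic hp 0).congr_fun hIic measurableSet_Iic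
  have iIoi := (integrableOn_exp_mul_complex_Ioi hn 0).congr_fun hIoi measurableSet_Ioi
  refine ⟨?_, ?_⟩
  · rw [← integrableOn_univ, ← Set.Iic_union_Ioi (a := (0 : ℝ))]
    exact iIic.union iIoi
  · rw [← intervalIntegral.integral_Iic_add_Ioi iIic iIoi,
      ← setIntegral_congr_fun measurableSet_Iic hIic,
      ← setIntegral_congr_fun measurableSet_Ioi hIoi,
      integral_exp_mul_complex_Iic hp, integral_exp_mul_complex_Ioi hn]
    simp only [Complex.ofReal_zero, mul_zero, Complex.exp_zero]
    rw [neg_div, ← div_neg, neg_sub, one_div, one_div]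

theorem fourier_cexp_neg_mul_abs {z : ℂ} (hz : 0 < z.re) (w : ℝ) :
    FourierTransform.fourier (fun x : ℝ ↦ Complex.exp (-z * |x|)) w =
      2 * z * (((2 * π * w : ℝ) : ℂ) ^ 2 + z ^ 2)⁻¹ := by
  have ha : (-((2 * π * w : ℝ) : ℂ) * Complex.I).re = 0 := by
    rw [← Complex.ofReal_neg, Complex.re_ofReal_mul, Complex.I_re, mul_zero]
  have h := (integrable_and_integral_cexp_neg_mul_abs_add (z := z)
    (a := -((2 * π * w : ℝ) : ℂ) * Complex.I) (by rwa [ha, abs_zero])).2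
  rw [Real.fourier_real_eq_integral_exp_smul]
  have hx (x : ℝ) : Complex.exp ((-2 * π * x * w : ℝ) * Complex.I) • Complex.exp (-z * |x|) =
      Complex.exp (-z * |x| + -((2 * π * w : ℝ) : ℂ) * Complex.I * x) := by
    rw [smul_eq_mul, ← Complex.exp_add]
    push_cast
    ring_nf
  simp only [hx]
  rw [h]
  generalize (2 * π * w : ℝ) = s at ha
  have h₁ : z + -(s : ℂ) * Complex.I ≠ 0 := fun h ↦ by
    have := congrArg Complex.re h
    rw [Complex.add_re, ha, Complex.zero_re] at this
    linarith
  have h₂ : z - -(s : ℂ) * Complex.I ≠ 0 := fun h ↦ by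
    have := congrArg Complex.re h
    rw [Complex.sub_re, ha, Complex.zero_re] at this
    linarith
  rw [inv_add_inv h₁ h₂, div_eq_mul_inv]
  congr 2
  · ring
  · linear_combination -(s : ℂ) ^ 2 * Complex.I_sq

theorem integral_cexp_div_sq_add_sq {z : ℂ} (hz : 0 < z.re) (x : ℝ) :
    ∫ s : ℝ, Complex.exp (Complex.I * (s * x : ℝ)) / ((s : ℂ) ^ 2 + z ^ 2) =
      π * Complex.exp (-z * |x|) / z := by
  have hz0 : z ≠ 0 := by rintro rfl; simp at hz
  have hpi : (2 * π : ℝ) ≠ 0 := by positivity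
  have hint : Integrable (fun x : ℝ ↦ Complex.exp (-z * |x|)) := by
    simpa using (integrable_and_integral_cexp_neg_mul_abs_add (z := z) (a := 0)
      (by simpa using hz)).1
  have hF : FourierTransform.fourier (fun x : ℝ ↦ Complex.exp (-z * |x|)) =
      fun w : ℝ ↦ 2 * z * (((2 * π * w : ℝ) : ℂ) ^ 2 + z ^ 2)⁻¹ :=
    funext (fourier_cexp_neg_mul_abs hz)
  have hFint : Integrable (FourierTransform.fourier fun x : ℝ ↦ Complex.exp (-z * |x|)) := by
    rw [hF]
    exact ((integrable_inv_sq_add_sq hz).comp_mul_left' hpi).const_mul (2 * z)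
  have h := congrFun (Continuous.fourierInv_fourier_eq (by fun_prop) hint hFint) x
  rw [hF, Real.fourierInv_eq'] at h
  have hv (v : ℝ) : Complex.exp ((2 * π * ⟪v, x⟫ : ℝ) * Complex.I) •
        (2 * z * (((2 * π * v : ℝ) : ℂ) ^ 2 + z ^ 2)⁻¹) =
      2 * z * (fun s : ℝ ↦ Complex.exp (Complex.I * (s * x : ℝ)) / ((s : ℂ) ^ 2 + z ^ 2))
        (2 * π * v) := by
    have hin : ⟪v, x⟫ = v * x := by simp [mul_comm]
    rw [hin, smul_eq_mul, ← mul_assoc (2 * π), mul_comm _ Complex.I]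
    ring
  simp only [hv] at h
  have hscale := Measure.integral_comp_mul_left (fun s : ℝ ↦
    Complex.exp (Complex.I * (s * x : ℝ)) / ((s : ℂ) ^ 2 + z ^ 2)) (2 * π)
  rw [integral_const_mul, hscale, abs_of_pos (by positivity),
    Complex.real_smul] at h
  rw [← h]
  generalize ∫ s : ℝ, Complex.exp (Complex.I * (s * x : ℝ)) / ((s : ℂ) ^ 2 + z ^ 2) = J
  push_cast
  have : (π : ℂ) ≠ 0 := by exact_mod_cast pi_ne_zero
  field_simp

/-- For odd `n`, the Euclidean Fourier integral
`∫_{ℝⁿ} e^{i⟨ξ,x⟩} / (‖ξ‖² + z²)^{(n+1)/2} dξ` evaluates to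
`(π^{(n+1)/2} / ((n−1)/2)!) e^{−‖x‖z} / z`. -/
theorem integral_odd_dim (n : ℕ) (hn : 1 ≤ n) (hodd : Odd n)
    (z : ℂ) (hz : 0 < z.re) (x : EuclideanSpace ℝ (Fin n)) :
    ∫ ξ : EuclideanSpace ℝ (Fin n),
        Complex.exp (Complex.I * (⟪ξ, x⟫ : ℝ)) / ((‖ξ‖ : ℂ) ^ 2 + z ^ 2) ^ ((n + 1) / 2) =
      ((π : ℂ) ^ ((n + 1) / 2) / (Nat.factorial ((n - 1) / 2) : ℂ)) *
        Complex.exp (-(‖x‖ : ℂ) * z) / z := by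
  obtain ⟨k, rfl⟩ := hodd
  have hc : 0 < ((starRingEnd ℂ) z).re := by simpa using hz
  have hcz := re_conj_mul_sq_pos hz
  have h₁ := integral_cexp_inner_div_norm_sq_add_pow (k := 0) (by simp) hc hcz ‖x‖
  have hs (s : ℝ) : ((‖s‖ : ℝ) : ℂ) ^ 2 = (s : ℂ) ^ 2 := by
    rw [← Complex.ofReal_pow, Real.norm_eq_abs, sq_abs, Complex.ofReal_pow]
  have hi (s : ℝ) : ⟪s, ‖x‖⟫ = s * ‖x‖ := by simp [mul_comm]
  simp only [hs, hi, zero_add, pow_one, pow_zero, Nat.factorial_zero, Nat.cast_one, div_one,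
    one_mul, norm_norm] at h₁
  rw [integral_cexp_div_sq_add_sq hz, abs_norm] at h₁
  rw [show (2 * k + 1 + 1) / 2 = k + 1 by omega, show (2 * k + 1 - 1) / 2 = k by omega,
    integral_cexp_inner_div_norm_sq_add_pow (by simp) hc hcz x, ← h₁, pow_succ,
    mul_comm (-z)]
  ring_nf
end

section
/- Let ℓ ≥ 0 be an integer, let z ∈ ℂ with Re(z) > 0, and let A > 0 be real. Then ∫_ℝ e^{iAt} / (t² + z²)^{ℓ+1} dt = (π e^{−Az} / z^{2ℓ+1}) · Σ_{k=0}^{ℓ} ((2ℓ − k)! / (2^{2ℓ−k} · ℓ! · (ℓ − k)! · k!)) · (Az)^k. -/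
open Real MeasureTheory

/-- The coefficient `(2ℓ−k)! / (2^{2ℓ−k} ℓ! (ℓ−k)! k!)`. -/
noncomputable def besselCoeff (ℓ k : ℕ) : ℂ :=
  (Nat.factorial (2 * ℓ - k) : ℂ) /
    (2 ^ (2 * ℓ - k) * (Nat.factorial ℓ : ℂ) * (Nat.factorial (ℓ - k) : ℂ) * (Nat.factorial k : ℂ))

lemma besselCoeff_succ_zero (ℓ : ℕ) :
    2 * ((ℓ : ℂ) + 1) * besselCoeff (ℓ + 1) 0 = (2 * ℓ + 1) * besselCoeff ℓ 0 := by
  have h1 := Nat.cast_ne_zero (R := ℂ).mpr ℓ.factorial_ne_zero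
  have h2 : (ℓ : ℂ) + 1 ≠ 0 := Nat.cast_add_one_ne_zero ℓ
  simp only [besselCoeff, Nat.sub_zero, show 2 * (ℓ + 1) = 2 * ℓ + 1 + 1 by ring,
    Nat.factorial_succ, Nat.factorial_zero, pow_succ]
  push_cast
  field_simp
  ring

lemma besselCoeff_succ_top (ℓ : ℕ) :
    2 * ((ℓ : ℂ) + 1) * besselCoeff (ℓ + 1) (ℓ + 1) = besselCoeff ℓ ℓ := by
  have h1 := Nat.cast_ne_zero (R := ℂ).mpr ℓ.factorial_ne_zero
  have h2 : (ℓ : ℂ) + 1 ≠ 0 := Nat.cast_add_one_ne_zero ℓ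
  simp only [besselCoeff, show 2 * (ℓ + 1) - (ℓ + 1) = ℓ + 1 by omega,
    show 2 * ℓ - ℓ = ℓ by omega, Nat.sub_self, Nat.factorial_succ, Nat.factorial_zero, pow_succ]
  push_cast
  field_simp

lemma besselCoeff_succ_succ {ℓ k : ℕ} (hk : k < ℓ) :
    2 * ((ℓ : ℂ) + 1) * besselCoeff (ℓ + 1) (k + 1) =
      (2 * ℓ - k) * besselCoeff ℓ (k + 1) + besselCoeff ℓ k := by
  obtain ⟨d, rfl⟩ := Nat.exists_eq_add_of_lt hk
  have h1 := Nat.cast_ne_zero (R := ℂ).mpr (k + d + 1).factorial_ne_zero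
  have h2 : ((k + d + 1 : ℕ) : ℂ) + 1 ≠ 0 := Nat.cast_add_one_ne_zero _
  have h3 := Nat.cast_ne_zero (R := ℂ).mpr d.factorial_ne_zero
  have h4 : (d : ℂ) + 1 ≠ 0 := Nat.cast_add_one_ne_zero _
  have h5 := Nat.cast_ne_zero (R := ℂ).mpr k.factorial_ne_zero
  have h6 : (k : ℂ) + 1 ≠ 0 := Nat.cast_add_one_ne_zero _
  simp only [besselCoeff, show 2 * (k + d + 1 + 1) - (k + 1) = k + 2 * d + 1 + 1 + 1 by omega,
    show 2 * (k + d + 1) - (k + 1) = k + 2 * d + 1 by omega,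
    show 2 * (k + d + 1) - k = k + 2 * d + 1 + 1 by omega,
    show k + d + 1 + 1 - (k + 1) = d + 1 by omega,
    show k + d + 1 - (k + 1) = d by omega, show k + d + 1 - k = d + 1 by omega,
    Nat.factorial_succ (k + d + 1), Nat.factorial_succ k, Nat.factorial_succ d,
    Nat.factorial_succ (k + 2 * d + 1 + 1), Nat.factorial_succ (k + 2 * d + 1),
    pow_succ _ (k + 2 * d + 1), pow_succ _ (k + 2 * d + 1 + 1)]
  simp only [Nat.cast_mul, Nat.cast_add, Nat.cast_one, Nat.cast_ofNat] at h2 ⊢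
  field_simp
  ring

/-- The recurrence `2 (ℓ + 1) P_{ℓ+1} = (2 ℓ + 1 + x) P_ℓ - x P_ℓ'`. -/
lemma sum_besselCoeff_succ (ℓ : ℕ) (x : ℂ) :
    2 * ((ℓ : ℂ) + 1) * ∑ k ∈ Finset.range (ℓ + 2), besselCoeff (ℓ + 1) k * x ^ k =
      (2 * ℓ + 1 + x) * ∑ k ∈ Finset.range (ℓ + 1), besselCoeff ℓ k * x ^ k -
        x * ∑ k ∈ Finset.range (ℓ + 1), besselCoeff ℓ k * (k * x ^ (k - 1)) := by
  have hsplit : (2 * ℓ + 1 + x) * ∑ k ∈ Finset.range (ℓ + 1), besselCoeff ℓ k * x ^ k -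
        x * ∑ k ∈ Finset.range (ℓ + 1), besselCoeff ℓ k * (k * x ^ (k - 1)) =
      ∑ k ∈ Finset.range (ℓ + 1), (2 * ℓ + 1 - k) * besselCoeff ℓ k * x ^ k +
        ∑ k ∈ Finset.range (ℓ + 1), besselCoeff ℓ k * x ^ (k + 1) := by
    simp only [Finset.mul_sum, ← Finset.sum_add_distrib, ← Finset.sum_sub_distrib]
    refine Finset.sum_congr rfl fun k _ => ?_
    cases k with
    | zero => simp; ring
    | succ k => simp only [Nat.add_sub_cancel]; push_cast; ring
  rw [hsplit, Finset.sum_range_succ', Finset.sum_range_succ _ ℓ, Finset.sum_range_succ' _ ℓ,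
    Finset.sum_range_succ _ ℓ]
  have hmid : 2 * ((ℓ : ℂ) + 1) *
        ∑ k ∈ Finset.range ℓ, besselCoeff (ℓ + 1) (k + 1) * x ^ (k + 1) =
      ∑ k ∈ Finset.range ℓ, (2 * ℓ + 1 - ((k + 1 : ℕ) : ℂ)) * besselCoeff ℓ (k + 1) * x ^ (k + 1) +
        ∑ k ∈ Finset.range ℓ, besselCoeff ℓ k * x ^ (k + 1) := by
    rw [Finset.mul_sum, ← Finset.sum_add_distrib]
    refine Finset.sum_congr rfl fun k hk => ?_
    have h := besselCoeff_succ_succ (Finset.mem_range.mp hk)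
    push_cast
    linear_combination x ^ (k + 1) * h
  have htop := besselCoeff_succ_top ℓ
  have hzero := besselCoeff_succ_zero ℓ
  simp only [pow_zero, mul_one, Nat.cast_zero, sub_zero]
  linear_combination hmid + x ^ (ℓ + 1) * htop + hzero

lemma sq_re_le_norm_sq_add_sq {z : ℂ} (hz : 0 ≤ z.re) (t : ℝ) :
    z.re ^ 2 ≤ ‖(t : ℂ) ^ 2 + z ^ 2‖ := by
  have hfac : (t : ℂ) ^ 2 + z ^ 2 = (t + Complex.I * z) * (t - Complex.I * z) := by
    linear_combination z ^ 2 * Complex.I_sq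
  have h1 := Complex.abs_im_le_norm ((t : ℂ) + Complex.I * z)
  have h2 := Complex.abs_im_le_norm ((t : ℂ) - Complex.I * z)
  simp only [Complex.add_im, Complex.sub_im, Complex.ofReal_im, Complex.mul_im, Complex.I_re,
    Complex.I_im, zero_mul, one_mul, zero_add, zero_sub, abs_neg, abs_of_nonneg hz] at h1 h2
  rw [hfac, norm_mul, pow_two]
  gcongr

lemma sq_add_sq_ne_zero {z : ℂ} (hz : 0 < z.re) (t : ℝ) : (t : ℂ) ^ 2 + z ^ 2 ≠ 0 :=
  norm_pos_iff.mp ((pow_pos hz 2).trans_le (sq_re_le_norm_sq_add_sq hz.le t))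

/-- A lower bound for `|t² + z²|` which is uniform in `z` on compact subsets of `Re z > 0`. -/
lemma mul_one_add_sq_le_norm {z : ℂ} {δ M : ℝ} (hδ : 0 < δ) (hz : δ ≤ z.re) (hM : 1 ≤ M)
    (hzM : ‖z‖ ≤ M) (t : ℝ) :
    δ ^ 2 / (2 * M ^ 2 + δ ^ 2) * (1 + t ^ 2) ≤ ‖(t : ℂ) ^ 2 + z ^ 2‖ := by
  have h1 : δ ^ 2 ≤ ‖(t : ℂ) ^ 2 + z ^ 2‖ :=
    (pow_le_pow_left₀ hδ.le hz 2).trans (sq_re_le_norm_sq_add_sq (hδ.le.trans hz) t)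
  have h2 : t ^ 2 - M ^ 2 ≤ ‖(t : ℂ) ^ 2 + z ^ 2‖ := by
    have h := norm_sub_le ((t : ℂ) ^ 2 + z ^ 2) (z ^ 2)
    have hzM2 := pow_le_pow_left₀ (norm_nonneg z) hzM 2
    simp only [add_sub_cancel_right, norm_pow, Complex.norm_real, norm_eq_abs, sq_abs] at h
    linarith
  have hM2 : 1 ≤ M ^ 2 := one_le_pow₀ hM
  rw [div_mul_eq_mul_div, div_le_iff₀ (by positivity)]
  nlinarith [mul_le_mul_of_nonneg_left h2 (sq_nonneg δ), mul_le_mul_of_nonneg_left h1 (sq_nonneg M),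
    mul_le_mul_of_nonneg_left hM2 (sq_nonneg δ)]

lemma norm_exp_I_mul_ofReal_mul_ofReal (A t : ℝ) :
    ‖Complex.exp (Complex.I * ((A : ℂ) * (t : ℂ)))‖ = 1 := by
  rw [← Complex.ofReal_mul, mul_comm]
  exact Complex.norm_exp_ofReal_mul_I _

lemma norm_exp_div_sq_add_sq_pow_le {z : ℂ} {δ M : ℝ} (hδ : 0 < δ) (hz : δ ≤ z.re) (hM : 1 ≤ M)
    (hzM : ‖z‖ ≤ M) (A t : ℝ) (n : ℕ) :
    ‖Complex.exp (Complex.I * ((A : ℂ) * (t : ℂ))) / ((t : ℂ) ^ 2 + z ^ 2) ^ (n + 1)‖ ≤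
      ((δ ^ 2 / (2 * M ^ 2 + δ ^ 2)) ^ (n + 1))⁻¹ * (1 + t ^ 2)⁻¹ := by
  have hc : 0 < δ ^ 2 / (2 * M ^ 2 + δ ^ 2) := by positivity
  have ht : 1 + t ^ 2 ≤ (1 + t ^ 2) ^ (n + 1) :=
    le_self_pow₀ (by nlinarith [sq_nonneg t]) (Nat.succ_ne_zero n)
  rw [norm_div, norm_exp_I_mul_ofReal_mul_ofReal, norm_pow, one_div, ← mul_inv]
  refine inv_anti₀ (by positivity) ?_
  calc _ ≤ (δ ^ 2 / (2 * M ^ 2 + δ ^ 2)) ^ (n + 1) * (1 + t ^ 2) ^ (n + 1) := by gcongr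
    _ = (δ ^ 2 / (2 * M ^ 2 + δ ^ 2) * (1 + t ^ 2)) ^ (n + 1) := (mul_pow _ _ _).symm
    _ ≤ _ := by gcongr; exact mul_one_add_sq_le_norm hδ hz hM hzM t

lemma continuous_exp_div_sq_add_sq_pow {z : ℂ} (hz : 0 < z.re) (A : ℝ) (n : ℕ) :
    Continuous fun t : ℝ =>
      Complex.exp (Complex.I * ((A : ℂ) * (t : ℂ))) / ((t : ℂ) ^ 2 + z ^ 2) ^ n :=
  Continuous.div (by fun_prop) (by fun_prop) fun t => pow_ne_zero _ (sq_add_sq_ne_zero hz t)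

lemma integrable_exp_div_sq_add_sq_pow {z : ℂ} (hz : 0 < z.re) (A : ℝ) (n : ℕ) :
    Integrable fun t : ℝ =>
      Complex.exp (Complex.I * ((A : ℂ) * (t : ℂ))) / ((t : ℂ) ^ 2 + z ^ 2) ^ (n + 1) :=
  (integrable_inv_one_add_sq.const_mul _).mono'
    (continuous_exp_div_sq_add_sq_pow hz A (n + 1)).aestronglyMeasurable
    (.of_forall fun t => norm_exp_div_sq_add_sq_pow_le hz le_rfl (le_max_right ‖z‖ 1)
      (le_max_left _ _) A t n)

/-- Differentiation in `z` under the integral sign. -/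
lemma hasDerivAt_integral_exp_div_sq_add_sq_pow {z : ℂ} (hz : 0 < z.re) (A : ℝ) (n : ℕ) :
    HasDerivAt
      (fun w : ℂ => ∫ t : ℝ,
        Complex.exp (Complex.I * ((A : ℂ) * (t : ℂ))) / ((t : ℂ) ^ 2 + w ^ 2) ^ (n + 1))
      (-(2 * ((n : ℂ) + 1) * z) * ∫ t : ℝ,
        Complex.exp (Complex.I * ((A : ℂ) * (t : ℂ))) / ((t : ℂ) ^ 2 + z ^ 2) ^ (n + 2)) z := by
  have hs : {w : ℂ | z.re / 2 < w.re ∧ ‖w‖ < ‖z‖ + 1} ∈ nhds z :=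
    ((isOpen_lt continuous_const Complex.continuous_re).inter
      (isOpen_lt continuous_norm continuous_const)).mem_nhds
        ⟨half_lt_self hz, lt_add_one ‖z‖⟩
  have hδ : 0 < z.re / 2 := half_pos hz
  rw [← integral_const_mul]
  refine (hasDerivAt_integral_of_dominated_loc_of_deriv_le (μ := volume)
    (F' := fun w (t : ℝ) => -(2 * ((n : ℂ) + 1) * w) *
      (Complex.exp (Complex.I * ((A : ℂ) * (t : ℂ))) / ((t : ℂ) ^ 2 + w ^ 2) ^ (n + 2)))
    (bound := fun t : ℝ => 2 * ((n : ℝ) + 1) * (‖z‖ + 1) *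
      ((((z.re / 2) ^ 2 / (2 * (‖z‖ + 1) ^ 2 + (z.re / 2) ^ 2)) ^ (n + 2))⁻¹ * (1 + t ^ 2)⁻¹))
    hs ?_ (integrable_exp_div_sq_add_sq_pow hz A n) ?_ ?_ ?_ ?_).2
  · filter_upwards [hs] with w hw
    exact (continuous_exp_div_sq_add_sq_pow (hδ.trans hw.1) A (n + 1)).aestronglyMeasurable
  · exact ((continuous_exp_div_sq_add_sq_pow hz A (n + 2)).const_mul _).aestronglyMeasurable
  · refine .of_forall fun t w hw => ?_
    rw [norm_mul]
    refine mul_le_mul ?_ (norm_exp_div_sq_add_sq_pow_le hδ hw.1.le (by simp) hw.2.le A t (n + 1))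
      (norm_nonneg _) (by positivity)
    have hn : ‖(n : ℂ) + 1‖ = n + 1 := by
      exact_mod_cast Complex.norm_natCast (n + 1)
    rw [norm_neg, norm_mul, norm_mul, hn, Complex.norm_two]
    gcongr
    exact hw.2.le
  · exact (integrable_inv_one_add_sq.const_mul _).const_mul _
  · refine .of_forall fun t w hw => ?_
    have hne := sq_add_sq_ne_zero (hδ.trans hw.1) t
    have h := (hasDerivAt_const w (Complex.exp (Complex.I * ((A : ℂ) * (t : ℂ))))).div
      ((((hasDerivAt_id w).pow 2).const_add ((t : ℂ) ^ 2)).pow (n + 1)) (pow_ne_zero _ hne)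
    refine h.congr_deriv ?_
    simp only [id, Pi.pow_apply, Nat.add_sub_cancel]
    push_cast
    field_simp
    ring

lemma integrable_and_fourier_exp_neg_mul_abs {z : ℂ} (hz : 0 < z.re) (w : ℝ) :
    Integrable (fun x : ℝ => Complex.exp (-z * (|x| : ℝ))) ∧
      FourierTransform.fourier (fun x : ℝ => Complex.exp (-z * (|x| : ℝ))) w =
        2 * z / (((2 * π * w : ℝ) : ℂ) ^ 2 + z ^ 2) := by
  set b : ℂ := ((-2 * π * w : ℝ) : ℂ) * Complex.I with hb
  have hbre : b.re = 0 := by simp [hb]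
  have hneg (c : ℂ) : Set.EqOn (fun x : ℝ => Complex.exp (c * x) * Complex.exp (-z * (|x| : ℝ)))
      (fun x : ℝ => Complex.exp ((c + z) * x)) (Set.Iic 0) := fun x hx => by
    simp only [abs_of_nonpos (Set.mem_Iic.mp hx), ← Complex.exp_add]
    congr 1; push_cast; ring
  have hpos (c : ℂ) : Set.EqOn (fun x : ℝ => Complex.exp (c * x) * Complex.exp (-z * (|x| : ℝ)))
      (fun x : ℝ => Complex.exp ((c - z) * x)) (Set.Ioi 0) := fun x hx => by
    simp only [abs_of_pos (Set.mem_Ioi.mp hx), ← Complex.exp_add]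
    congr 1; ring
  have hIic (c : ℂ) (hc : c.re = 0) : IntegrableOn
      (fun x : ℝ => Complex.exp (c * x) * Complex.exp (-z * (|x| : ℝ))) (Set.Iic 0) :=
    (integrableOn_exp_mul_complex_Iic (by simp [hc, hz]) 0).congr_fun (hneg c).symm
      measurableSet_Iic
  have hIoi (c : ℂ) (hc : c.re = 0) : IntegrableOn
      (fun x : ℝ => Complex.exp (c * x) * Complex.exp (-z * (|x| : ℝ))) (Set.Ioi 0) :=
    (integrableOn_exp_mul_complex_Ioi (by simp [hc, hz]) 0).congr_fun (hpos c).symm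
      measurableSet_Ioi
  constructor
  · have h := (hIic 0 rfl).union (hIoi 0 rfl)
    simpa [Set.Iic_union_Ioi] using h
  · have hfun : ∀ x : ℝ, Complex.exp (((-2 * π * x * w : ℝ) : ℂ) * Complex.I) •
        Complex.exp (-z * (|x| : ℝ)) = Complex.exp (b * x) * Complex.exp (-z * (|x| : ℝ)) := by
      intro x
      rw [smul_eq_mul, hb]
      congr 2; push_cast; ring
    rw [fourier_real_eq_integral_exp_smul]
    simp_rw [hfun]
    rw [← intervalIntegral.integral_Iic_add_Ioi (hIic b hbre) (hIoi b hbre),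
      setIntegral_congr_fun measurableSet_Iic (hneg b),
      setIntegral_congr_fun measurableSet_Ioi (hpos b),
      integral_exp_mul_complex_Iic (by simp [hbre, hz]),
      integral_exp_mul_complex_Ioi (by simp [hbre, hz])]
    have h1 : b + z ≠ 0 := fun h => by
      have := congrArg Complex.re h
      simp [hbre] at this; linarith
    have h2 : b - z ≠ 0 := fun h => by
      have := congrArg Complex.re h
      simp [hbre] at this; linarith
    have h3 : ((2 * π * w : ℝ) : ℂ) ^ 2 + z ^ 2 = -((b + z) * (b - z)) := by
      rw [hb]; push_cast
      linear_combination (4 * (π : ℂ) ^ 2 * w ^ 2) * Complex.I_sq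
    rw [h3]
    simp only [Complex.ofReal_zero, mul_zero, Complex.exp_zero]
    field_simp
    ring

/-- The case `ℓ = 0`, by Fourier inversion. -/
lemma integral_exp_div_sq_add_sq {z : ℂ} (hz : 0 < z.re) {A : ℝ} (hA : 0 ≤ A) :
    ∫ t : ℝ, Complex.exp (Complex.I * ((A : ℂ) * (t : ℂ))) / ((t : ℂ) ^ 2 + z ^ 2) =
      π * Complex.exp (-(A : ℂ) * z) / z := by
  have hz0 : z ≠ 0 := fun h => by simp [h] at hz
  have hpi : (π : ℂ) ≠ 0 := Complex.ofReal_ne_zero.mpr pi_ne_zero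
  have hF : FourierTransform.fourier (fun x : ℝ => Complex.exp (-z * (|x| : ℝ))) =
      fun w : ℝ => 2 * z / (((2 * π * w : ℝ) : ℂ) ^ 2 + z ^ 2) :=
    funext fun w => (integrable_and_fourier_exp_neg_mul_abs hz w).2
  have hFint : Integrable fun w : ℝ => 2 * z / (((2 * π * w : ℝ) : ℂ) ^ 2 + z ^ 2) := by
    have h := ((integrable_exp_div_sq_add_sq_pow hz 0 0).const_mul (2 * z)).comp_mul_left'
      (R := 2 * π) (by positivity)
    simpa [mul_one_div, div_eq_mul_inv] using h
  have hinv := congrFun (Continuous.fourierInv_fourier_eq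
    (f := fun x : ℝ => Complex.exp (-z * (|x| : ℝ))) (by fun_prop)
    (integrable_and_fourier_exp_neg_mul_abs hz 0).1 (hF ▸ hFint)) A
  rw [hF, fourierInv_eq'] at hinv
  have hsub := Measure.integral_comp_mul_left (fun t : ℝ =>
    Complex.exp (Complex.I * ((A : ℂ) * (t : ℂ))) / ((t : ℂ) ^ 2 + z ^ 2)) (2 * π)
  have hfun : ∀ w : ℝ, Complex.exp (((2 * π * inner ℝ w A : ℝ) : ℂ) * Complex.I) •
      (2 * z / (((2 * π * w : ℝ) : ℂ) ^ 2 + z ^ 2)) =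
      2 * z * (Complex.exp (Complex.I * ((A : ℂ) * ((2 * π * w : ℝ) : ℂ))) /
        (((2 * π * w : ℝ) : ℂ) ^ 2 + z ^ 2)) := by
    intro w
    rw [smul_eq_mul, mul_div_assoc', mul_div_assoc', mul_comm (2 * z)]
    congr 3
    simp
    ring
  simp_rw [hfun] at hinv
  rw [integral_const_mul, hsub, abs_of_pos (by positivity), abs_of_nonneg hA,
    Complex.real_smul] at hinv
  push_cast at hinv
  rw [show -(A : ℂ) * z = -z * A by ring, ← hinv]
  field_simp

/-- The derivative in `z` of the closed form. -/
lemma hasDerivAt_exp_div_pow_mul_sum_besselCoeff {z : ℂ} (hz : z ≠ 0) (A : ℂ) (ℓ : ℕ) :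
    HasDerivAt
      (fun w : ℂ => π * Complex.exp (-A * w) / w ^ (2 * ℓ + 1) *
        ∑ k ∈ Finset.range (ℓ + 1), besselCoeff ℓ k * (A * w) ^ k)
      (-(2 * ((ℓ : ℂ) + 1) * z) * (π * Complex.exp (-A * z) / z ^ (2 * (ℓ + 1) + 1) *
        ∑ k ∈ Finset.range (ℓ + 2), besselCoeff (ℓ + 1) k * (A * z) ^ k)) z := by
  have hlin : HasDerivAt (fun w : ℂ => A * w) A z := by
    simpa using (hasDerivAt_id z).const_mul A
  have hexp : HasDerivAt (fun w : ℂ => Complex.exp (-A * w)) (Complex.exp (-A * z) * -A) z := by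
    have h : HasDerivAt (fun w : ℂ => -A * w) (-A) z := by
      simpa using (hasDerivAt_id z).const_mul (-A)
    exact h.cexp
  have hsum : HasDerivAt (fun w : ℂ => ∑ k ∈ Finset.range (ℓ + 1), besselCoeff ℓ k * (A * w) ^ k)
      (∑ k ∈ Finset.range (ℓ + 1), besselCoeff ℓ k * (k * (A * z) ^ (k - 1) * A)) z :=
    HasDerivAt.fun_sum fun k _ => (hlin.pow k).const_mul _
  refine (((hexp.const_mul (π : ℂ)).div (hasDerivAt_pow (2 * ℓ + 1) z)
    (pow_ne_zero _ hz)).mul hsum).congr_deriv ?_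
  have hrec := sum_besselCoeff_succ ℓ (A * z)
  have hA : ∑ k ∈ Finset.range (ℓ + 1), besselCoeff ℓ k * (k * (A * z) ^ (k - 1) * A) =
      A * ∑ k ∈ Finset.range (ℓ + 1), besselCoeff ℓ k * (k * (A * z) ^ (k - 1)) := by
    rw [Finset.mul_sum]
    exact Finset.sum_congr rfl fun k _ => by ring
  rw [hA]
  generalize ∑ k ∈ Finset.range (ℓ + 1), besselCoeff ℓ k * (k * (A * z) ^ (k - 1)) = Q at *
  generalize ∑ k ∈ Finset.range (ℓ + 1), besselCoeff ℓ k * (A * z) ^ k = P at *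
  generalize ∑ k ∈ Finset.range (ℓ + 2), besselCoeff (ℓ + 1) k * (A * z) ^ k = R at *
  have hR : -(2 * ((ℓ : ℂ) + 1) * z) * (π * Complex.exp (-A * z) / z ^ (2 * (ℓ + 1) + 1) * R) =
      -z * (π * Complex.exp (-A * z) / z ^ (2 * (ℓ + 1) + 1)) *
        ((2 * ℓ + 1 + A * z) * P - A * z * Q) := by
    rw [← hrec]; ring
  rw [hR]
  simp only [Pi.div_apply, Nat.add_sub_cancel, show 2 * (ℓ + 1) + 1 = 2 * ℓ + 1 + 1 + 1 by ring, pow_succ]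
  push_cast
  field_simp
  ring

/-- For `Re z > 0` and `A > 0`,
`∫_ℝ e^{iAt}/(t²+z²)^{ℓ+1} dt = (π e^{−Az}/z^{2ℓ+1}) ∑_{k=0}^{ℓ} a_k (Az)^k`
with `a_k = (2ℓ−k)! / (2^{2ℓ−k} ℓ! (ℓ−k)! k!)`. -/
theorem integral_one_dim_int_power (ℓ : ℕ) (z : ℂ) (hz : 0 < z.re) (A : ℝ) (hA : 0 < A) :
    ∫ t : ℝ, Complex.exp (Complex.I * ((A : ℂ) * (t : ℂ))) / ((t : ℂ) ^ 2 + z ^ 2) ^ (ℓ + 1) =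
      (π : ℂ) * Complex.exp (-(A : ℂ) * z) / z ^ (2 * ℓ + 1) *
        ∑ k ∈ Finset.range (ℓ + 1),
          ((Nat.factorial (2 * ℓ - k) : ℂ) /
              (2 ^ (2 * ℓ - k) * (Nat.factorial ℓ : ℂ) * (Nat.factorial (ℓ - k) : ℂ) *
                (Nat.factorial k : ℂ))) *
            ((A : ℂ) * z) ^ k := by
  change _ = (π : ℂ) * Complex.exp (-(A : ℂ) * z) / z ^ (2 * ℓ + 1) *
    ∑ k ∈ Finset.range (ℓ + 1), besselCoeff ℓ k * ((A : ℂ) * z) ^ k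
  induction ℓ generalizing z with
  | zero => simpa [besselCoeff] using integral_exp_div_sq_add_sq hz hA.le
  | succ ℓ ih =>
    have hz0 : z ≠ 0 := fun h => by simp [h] at hz
    have hev := Filter.eventuallyEq_of_mem
      ((isOpen_lt continuous_const Complex.continuous_re).mem_nhds hz) ih
    have h := (hasDerivAt_integral_exp_div_sq_add_sq_pow hz A ℓ).unique
      ((hasDerivAt_exp_div_pow_mul_sum_besselCoeff hz0 (A : ℂ) ℓ).congr_of_eventuallyEq hev)
    refine mul_left_cancel₀ (neg_ne_zero.mpr (mul_ne_zero (mul_ne_zero two_ne_zero ?_) hz0)) h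
    exact Nat.cast_add_one_ne_zero ℓ
end

section
/- Let n ≥ 1, let ν be a real number with ν > n/2, let z ∈ ℂ with Re(z) > 0, and let x ∈ ℝⁿ. Then ∫_{ℝⁿ} e^{i⟨ξ, x⟩} / (‖ξ‖² + z²)^ν dξ = π^{(n−1)/2} · (Γ(ν − (n−1)/2) / Γ(ν)) · ∫_ℝ e^{i‖x‖ t} / (t² + z²)^{ν − (n−1)/2} dt. -/
open scoped RealInnerProductSpace
open Real MeasureTheory

/-- The complex power is multiplicative on the right half plane. -/
theorem Complex.mul_cpow_of_re_pos {a b : ℂ} (ha : 0 < a.re) (hb : 0 < b.re) (s : ℂ) :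
    (a * b) ^ s = a ^ s * b ^ s := by
  have ha0 : a ≠ 0 := by rintro rfl; simp at ha
  have hb0 : b ≠ 0 := by rintro rfl; simp at hb
  have h₁ := abs_lt.1 (Complex.abs_arg_lt_pi_div_two_iff.2 (Or.inl ha))
  have h₂ := abs_lt.1 (Complex.abs_arg_lt_pi_div_two_iff.2 (Or.inl hb))
  rw [Complex.cpow_def_of_ne_zero (mul_ne_zero ha0 hb0), Complex.cpow_def_of_ne_zero ha0,
    Complex.cpow_def_of_ne_zero hb0, Complex.log_mul ha0 hb0 ⟨by linarith, by linarith⟩,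
    add_mul, Complex.exp_add]

theorem Real.integrableOn_rpow_mul_exp_neg_mul {ν r : ℝ} (hν : 0 < ν) (hr : 0 < r) :
    IntegrableOn (fun t : ℝ => t ^ (ν - 1) * rexp (-(r * t))) (Set.Ioi 0) := by
  simpa using integrableOn_rpow_mul_exp_neg_mul_rpow (p := 1) (by linarith : -1 < ν - 1)
    one_pos hr

theorem norm_rpow_mul_cexp_neg_mul (ν : ℝ) (r : ℂ) {t : ℝ} (ht : 0 < t) :
    ‖((t ^ (ν - 1) : ℝ) : ℂ) * Complex.exp (-(r * t))‖ = t ^ (ν - 1) * rexp (-(r.re * t)) := by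
  rw [norm_mul, Complex.norm_real, Complex.norm_exp, Real.norm_of_nonneg (by positivity)]
  simp

theorem aestronglyMeasurable_rpow_mul_cexp_neg_mul (ν : ℝ) (r : ℂ) (μ : Measure ℝ) :
    AEStronglyMeasurable (fun t : ℝ => ((t ^ (ν - 1) : ℝ) : ℂ) * Complex.exp (-(r * t))) μ := by
  apply Measurable.aestronglyMeasurable
  fun_prop

theorem integrableOn_rpow_mul_cexp_neg_mul {ν : ℝ} (hν : 0 < ν) {r : ℂ} (hr : 0 < r.re) :
    IntegrableOn (fun t : ℝ => ((t ^ (ν - 1) : ℝ) : ℂ) * Complex.exp (-(r * t)))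
      (Set.Ioi 0) := by
  refine (Real.integrableOn_rpow_mul_exp_neg_mul hν hr).mono'
    (aestronglyMeasurable_rpow_mul_cexp_neg_mul _ _ _) ?_
  filter_upwards [ae_restrict_mem measurableSet_Ioi] with t ht
  exact (norm_rpow_mul_cexp_neg_mul ν r ht).le

theorem differentiableAt_integral_rpow_mul_cexp_neg_mul {ν : ℝ} (hν : 0 < ν) {r : ℂ}
    (hr : 0 < r.re) :
    DifferentiableAt ℂ
      (fun r : ℂ => ∫ t in Set.Ioi (0 : ℝ), ((t ^ (ν - 1) : ℝ) : ℂ) * Complex.exp (-(r * t))) r := by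
  have hr2 : 0 < r.re / 2 := by linarith
  refine (hasDerivAt_integral_of_dominated_loc_of_deriv_le (Metric.ball_mem_nhds r hr2)
    (F' := fun (r : ℂ) (t : ℝ) => ((t ^ (ν - 1) : ℝ) : ℂ) * (Complex.exp (-(r * t)) * (-t)))
    (bound := fun t => t ^ (ν + 1 - 1) * rexp (-(r.re / 2 * t)))
    (Filter.Eventually.of_forall fun w => aestronglyMeasurable_rpow_mul_cexp_neg_mul ν w _)
    (integrableOn_rpow_mul_cexp_neg_mul hν hr) ?_ ?_
    (Real.integrableOn_rpow_mul_exp_neg_mul (by linarith) hr2) ?_).2.differentiableAt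
  · apply Measurable.aestronglyMeasurable
    fun_prop
  · filter_upwards [ae_restrict_mem measurableSet_Ioi] with t (ht : 0 < t) w hw
    have hw' : r.re / 2 ≤ w.re := by
      have h₁ := (Complex.abs_re_le_norm (w - r)).trans (mem_ball_iff_norm.1 hw).le
      have h₂ := (abs_le.1 h₁).1
      rw [Complex.sub_re] at h₂
      linarith
    rw [← mul_assoc, norm_mul, norm_rpow_mul_cexp_neg_mul ν w ht, norm_neg, Complex.norm_real,
      Real.norm_of_nonneg ht.le, mul_right_comm, ← Real.rpow_add_one ht.ne',
      show ν - 1 + 1 = ν + 1 - 1 by ring]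
    gcongr
  · refine Filter.Eventually.of_forall fun t w _ => ?_
    have h : HasDerivAt (fun w : ℂ => -(w * t)) (-t : ℂ) w := by
      simpa using ((hasDerivAt_id w).mul_const (t : ℂ)).fun_neg
    exact h.cexp.const_mul _

/-- The Laplace transform of `t ^ (ν - 1)` on the right half plane. -/
theorem integral_rpow_mul_cexp_neg_mul {ν : ℝ} (hν : 0 < ν) {r : ℂ} (hr : 0 < r.re) :
    ∫ t in Set.Ioi (0 : ℝ), ((t ^ (ν - 1) : ℝ) : ℂ) * Complex.exp (-(r * t)) =
      (Real.Gamma ν : ℂ) / r ^ (ν : ℂ) := by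
  have hopen : IsOpen {w : ℂ | 0 < w.re} := isOpen_lt continuous_const Complex.continuous_re
  have hne : ∀ w ∈ {w : ℂ | 0 < w.re}, w ^ (ν : ℂ) ≠ 0 := fun w hw => by
    have : w ≠ 0 := by rintro rfl; simp at hw
    simp [Complex.cpow_eq_zero_iff, this]
  have hL : AnalyticOnNhd ℂ
      (fun r : ℂ => ∫ t in Set.Ioi (0 : ℝ), ((t ^ (ν - 1) : ℝ) : ℂ) * Complex.exp (-(r * t)))
      {w : ℂ | 0 < w.re} := DifferentiableOn.analyticOnNhd
    (fun w hw => (differentiableAt_integral_rpow_mul_cexp_neg_mul hν hw).differentiableWithinAt)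
    hopen
  have hR : AnalyticOnNhd ℂ (fun r : ℂ => (Real.Gamma ν : ℂ) / r ^ (ν : ℂ))
      {w : ℂ | 0 < w.re} := DifferentiableOn.analyticOnNhd (fun w hw =>
    ((differentiableAt_const _).div (differentiableAt_id.cpow_const (Or.inl hw))
      (hne w hw)).differentiableWithinAt) hopen
  have hreal : ∀ x : ℝ, 0 < x →
      ∫ t in Set.Ioi (0 : ℝ), ((t ^ (ν - 1) : ℝ) : ℂ) * Complex.exp (-((x : ℂ) * t)) =
        (Real.Gamma ν : ℂ) / (x : ℂ) ^ (ν : ℂ) := fun x hx => by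
    have h := congrArg ((↑) : ℝ → ℂ) (Real.integral_rpow_mul_exp_neg_mul_Ioi hν hx)
    rw [← integral_complex_ofReal, Real.div_rpow zero_le_one hx.le, Real.one_rpow] at h
    push_cast at h
    rw [h, Complex.ofReal_cpow hx.le]
    ring
  refine hL.eqOn_of_preconnected_of_frequently_eq hR
    (convex_halfSpace_re_gt 0).isPreconnected (z₀ := 1) (by simp) ?_ hr
  have htend : Filter.Tendsto (fun x : ℝ => (x : ℂ)) (nhdsWithin 1 (Set.Ioi 1))
      (nhdsWithin 1 {1}ᶜ) := by
    refine tendsto_nhdsWithin_iff.2 ⟨?_, ?_⟩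
    · exact (Complex.continuous_ofReal.tendsto' 1 1 (by simp)).mono_left nhdsWithin_le_nhds
    · filter_upwards [self_mem_nhdsWithin] with x hx
      simpa using (ne_of_gt hx : x ≠ 1)
  refine htend.frequently (Filter.Eventually.frequently ?_)
  filter_upwards [self_mem_nhdsWithin] with x (hx : 1 < x)
  exact hreal x (by linarith)

section GaussianMixture

variable {V : Type*} [NormedAddCommGroup V] [InnerProductSpace ℝ V] [FiniteDimensional ℝ V]
  [MeasurableSpace V] [BorelSpace V]

theorem integrable_rpow_mul_gaussian_prod {ν : ℝ} (hν : (Module.finrank ℝ V : ℝ) / 2 < ν)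
    {a c : ℂ} (ha : 0 < a.re) (hc : 0 < c.re) (x : V) :
    Integrable (fun p : V × ℝ => ((p.2 ^ (ν - 1) : ℝ) : ℂ) * Complex.exp (-(c * p.2)) *
      Complex.exp (-(p.2 * a) * ‖p.1‖ ^ 2 + Complex.I * ⟪x, p.1⟫))
      ((volume : Measure V).prod (volume.restrict (Set.Ioi (0 : ℝ)))) := by
  have hmeas : Measurable (fun p : V × ℝ => ((p.2 ^ (ν - 1) : ℝ) : ℂ) *
      Complex.exp (-(c * p.2)) *
      Complex.exp (-(p.2 * a) * ‖p.1‖ ^ 2 + Complex.I * ⟪x, p.1⟫)) := by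
    fun_prop
  refine (integrable_prod_iff' hmeas.aestronglyMeasurable).2 ⟨?_, ?_⟩
  · filter_upwards [ae_restrict_mem measurableSet_Ioi] with s (hs : 0 < s)
    exact (GaussianFourier.integrable_cexp_neg_mul_sq_norm_add
      (by simpa using mul_pos hs ha) _ _).const_mul _
  · refine ((Real.integrableOn_rpow_mul_exp_neg_mul (sub_pos.2 hν) hc).const_mul
      ((π / a.re) ^ (Module.finrank ℝ V / 2 : ℝ))).congr ?_
    filter_upwards [ae_restrict_mem measurableSet_Ioi] with s (hs : 0 < s)
    have hnorm : ∀ ξ : V, ‖Complex.exp (-(s * a) * ‖ξ‖ ^ 2 + Complex.I * ⟪x, ξ⟫)‖ =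
        rexp (-(s * a.re) * ‖ξ‖ ^ 2) := fun ξ => by
      rw [Complex.norm_exp]
      congr 1
      simp [← Complex.ofReal_pow]
    simp_rw [norm_mul _ (Complex.exp (-(s * a) * _ + _)), norm_rpow_mul_cexp_neg_mul ν c hs,
      hnorm]
    rw [integral_const_mul, GaussianFourier.integral_rexp_neg_mul_sq_norm (mul_pos hs ha),
      mul_comm s a.re, ← div_div, Real.div_rpow (by positivity) hs.le, sub_right_comm,
      Real.rpow_sub hs]
    ring

/-- The Fourier transform of `ξ ↦ (‖ξ‖ ^ 2 + v * c) ^ (-ν)` as a one-dimensional integral that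
depends on the dimension `d` only through `ν - d / 2`, up to a power of `π`. -/
theorem integral_cexp_inner_div_cpow {ν : ℝ} (hν : (Module.finrank ℝ V : ℝ) / 2 < ν)
    {v c : ℂ} (hv : 0 < v.re) (hc : 0 < c.re) (x : V) :
    (Real.Gamma ν : ℂ) * ∫ ξ : V,
        Complex.exp (Complex.I * (⟪ξ, x⟫ : ℝ)) / ((‖ξ‖ : ℂ) ^ 2 + v * c) ^ (ν : ℂ) =
      ((π ^ (Module.finrank ℝ V / 2 : ℝ) : ℝ) : ℂ) *
        (v ^ (-((ν - Module.finrank ℝ V / 2 : ℝ) : ℂ)) *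
          ∫ s in Set.Ioi (0 : ℝ), ((s ^ (ν - Module.finrank ℝ V / 2 - 1) : ℝ) : ℂ) *
            Complex.exp (-(c * s)) * Complex.exp (-(‖x‖ : ℂ) ^ 2 * v / (4 * s))) := by
  have hv0 : v ≠ 0 := by rintro rfl; simp at hv
  have hvinv : 0 < (v⁻¹).re := by
    rw [Complex.inv_re]
    exact div_pos hv (Complex.normSq_pos.2 hv0)
  have hν0 : 0 < ν := lt_of_le_of_lt (by positivity) hν
  have hξ : ∀ ξ : V, (Real.Gamma ν : ℂ) *
      (Complex.exp (Complex.I * (⟪ξ, x⟫ : ℝ)) / ((‖ξ‖ : ℂ) ^ 2 + v * c) ^ (ν : ℂ)) =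
      v ^ (-(ν : ℂ)) * ∫ s in Set.Ioi (0 : ℝ), ((s ^ (ν - 1) : ℝ) : ℂ) *
        Complex.exp (-(c * s)) *
        Complex.exp (-(s * v⁻¹) * ‖ξ‖ ^ 2 + Complex.I * ⟪x, ξ⟫) := fun ξ => by
    have hp : 0 < ((‖ξ‖ : ℂ) ^ 2 * v⁻¹ + c).re := by
      rw [← Complex.ofReal_pow, Complex.add_re, Complex.re_ofReal_mul]
      positivity
    rw [show (‖ξ‖ : ℂ) ^ 2 + v * c = v * ((‖ξ‖ : ℂ) ^ 2 * v⁻¹ + c) by field_simp,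
      Complex.mul_cpow_of_re_pos hv hp, Complex.cpow_neg]
    have : ∀ s : ℝ, ((s ^ (ν - 1) : ℝ) : ℂ) * Complex.exp (-(c * s)) *
        Complex.exp (-(s * v⁻¹) * ‖ξ‖ ^ 2 + Complex.I * ⟪x, ξ⟫) =
        Complex.exp (Complex.I * (⟪ξ, x⟫ : ℝ)) * (((s ^ (ν - 1) : ℝ) : ℂ) *
          Complex.exp (-(((‖ξ‖ : ℂ) ^ 2 * v⁻¹ + c) * s))) := fun s => by
      rw [mul_assoc, ← Complex.exp_add, mul_left_comm, ← Complex.exp_add, real_inner_comm]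
      congr 2
      ring
    simp_rw [this]
    rw [integral_const_mul, integral_rpow_mul_cexp_neg_mul hν0 hp]
    ring
  rw [← integral_const_mul]
  simp_rw [hξ]
  rw [integral_const_mul, integral_integral_swap (integrable_rpow_mul_gaussian_prod hν hvinv hc x)]
  simp_rw [integral_const_mul]
  rw [← integral_const_mul, ← integral_const_mul, ← integral_const_mul]
  refine setIntegral_congr_fun measurableSet_Ioi fun s (hs : 0 < s) => ?_
  have hs0 : (s : ℂ) ≠ 0 := by exact_mod_cast hs.ne'
  have hsv : (π : ℂ) / (s * v⁻¹) = ((π / s : ℝ) : ℂ) * v := by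
    push_cast; field_simp
  have hpow : ((Module.finrank ℝ V : ℂ) / 2) = ((Module.finrank ℝ V / 2 : ℝ) : ℂ) := by
    push_cast; rfl
  rw [GaussianFourier.integral_cexp_neg_mul_sq_norm_add
    (by simpa using mul_pos hs hvinv), hsv,
    Complex.mul_cpow_of_re_pos (by rw [Complex.ofReal_re]; positivity) hv, hpow,
    ← Complex.ofReal_cpow (by positivity), Real.div_rpow pi_pos.le hs.le,
    sub_right_comm ν _ 1, Real.rpow_sub hs (ν - 1), Complex.ofReal_sub, neg_sub, Complex.cpow_sub _ _ hv0, Complex.cpow_neg,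
    show Complex.I ^ 2 * (‖x‖ : ℂ) ^ 2 / (4 * (s * v⁻¹)) = -(‖x‖ : ℂ) ^ 2 * v / (4 * s) by
      rw [Complex.I_sq]; field_simp]
  push_cast
  ring

end GaussianMixture

/-- Reduction of the `n`-dimensional integral `∫_{ℝⁿ} e^{i⟨ξ,x⟩}/(‖ξ‖²+z²)^ν dξ` to a
one-dimensional integral, for real `ν > n/2` and `Re z > 0`. -/
theorem integral_reduce_to_one_dim (n : ℕ) (hn : 1 ≤ n) (ν : ℝ) (hν : (n : ℝ) / 2 < ν)
    (z : ℂ) (hz : 0 < z.re) (x : EuclideanSpace ℝ (Fin n)) :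
    ∫ ξ : EuclideanSpace ℝ (Fin n),
        Complex.exp (Complex.I * (⟪ξ, x⟫ : ℝ)) / ((‖ξ‖ : ℂ) ^ 2 + z ^ 2) ^ ((ν : ℂ)) =
      ((π ^ (((n : ℝ) - 1) / 2) : ℝ) : ℂ) *
        ((Real.Gamma (ν - ((n : ℝ) - 1) / 2) : ℂ) / (Real.Gamma ν : ℂ)) *
        ∫ t : ℝ,
          Complex.exp (Complex.I * ((‖x‖ : ℂ) * (t : ℂ))) /
            ((t : ℂ) ^ 2 + z ^ 2) ^ (((ν - ((n : ℝ) - 1) / 2 : ℝ)) : ℂ) := by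
  have hn' : (1 : ℝ) ≤ n := by exact_mod_cast hn
  have h₁ := integral_cexp_inner_div_cpow (V := EuclideanSpace ℝ (Fin n)) (ν := ν)
    (by simpa using hν) hz hz x
  have h₂ := integral_cexp_inner_div_cpow (V := ℝ) (ν := ν - ((n : ℝ) - 1) / 2)
    (by rw [Module.finrank_self, Nat.cast_one]; linarith) hz hz ‖x‖
  rw [finrank_euclideanSpace, Fintype.card_fin] at h₁
  rw [Module.finrank_self, Nat.cast_one, norm_norm,
    show ν - ((n : ℝ) - 1) / 2 - 1 / 2 = ν - n / 2 by ring] at h₂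
  have hline : ∀ t : ℝ, Complex.exp (Complex.I * (⟪t, ‖x‖⟫ : ℝ)) /
      ((‖t‖ : ℂ) ^ 2 + z * z) ^ ((ν - ((n : ℝ) - 1) / 2 : ℝ) : ℂ) =
      Complex.exp (Complex.I * ((‖x‖ : ℂ) * (t : ℂ))) /
        ((t : ℂ) ^ 2 + z * z) ^ ((ν - ((n : ℝ) - 1) / 2 : ℝ) : ℂ) := fun t => by
    rw [← Complex.ofReal_pow ‖t‖, Real.norm_eq_abs, sq_abs]
    simp
  simp_rw [hline] at h₂
  have hΓ : (Real.Gamma ν : ℂ) ≠ 0 := by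
    exact_mod_cast (Real.Gamma_pos_of_pos (by linarith)).ne'
  have hπ : π ^ ((n : ℝ) / 2) = π ^ (((n : ℝ) - 1) / 2) * π ^ ((1 : ℝ) / 2) := by
    rw [← Real.rpow_add pi_pos]
    congr 1
    ring
  rw [sq z]
  refine mul_left_cancel₀ hΓ ?_
  rw [h₁, hπ, Complex.ofReal_mul, mul_assoc, ← h₂]
  field_simp
end

section
/- Let m ≥ 1 be an odd integer, let z ∈ ℂ with Re(z) > 0, and set ν = (m+1)/2. Define u : ℝᵐ → ℂ by u(x) = (−1)^ν · (2π)^{−m} · (π^{(m+1)/2} / ((m−1)/2)!) · e^{−‖x‖ z} / z. Then u is a fundamental solution of (Δ − z²)^ν on ℝᵐ: for every Schwartz function φ : ℝᵐ → ℂ, ∫_{ℝᵐ} u(x) · ((Δ − z²)^ν φ)(x) dx = φ(0), where (Δ − z²)φ = Δφ − z²·φ and the operator is iterated ν times. -/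
open Real MeasureTheory

/-- The Laplacian of a smooth `f : ℝᵐ → ℂ`: the sum of second partial derivatives with
respect to the standard orthonormal basis of `EuclideanSpace ℝ (Fin m)`. -/
noncomputable def laplacianC {m : ℕ} (f : EuclideanSpace ℝ (Fin m) → ℂ)
    (x : EuclideanSpace ℝ (Fin m)) : ℂ :=
  ∑ i : Fin m,
    fderiv ℝ (fun y => fderiv ℝ f y (EuclideanSpace.single i 1)) x (EuclideanSpace.single i 1)

open SchwartzMap FourierTransform Laplacian LineDeriv

theorem laplacianC_coe_schwartz {m : ℕ} (f : 𝓢(EuclideanSpace ℝ (Fin m), ℂ))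
    (x : EuclideanSpace ℝ (Fin m)) : laplacianC f x = Δ f x := by
  rw [SchwartzMap.laplacian_eq_sum (EuclideanSpace.basisFun (Fin m) ℝ) f, sum_apply]
  simp only [EuclideanSpace.basisFun_apply, SchwartzMap.lineDerivOp_apply_eq_fderiv]
  rfl

/-- The operator `Δ - z²` on Schwartz functions. -/
noncomputable def helmholtz (m : ℕ) (z : ℂ) :
    Module.End ℂ 𝓢(EuclideanSpace ℝ (Fin m), ℂ) :=
  (laplacianCLM ℂ (EuclideanSpace ℝ (Fin m)) 𝓢(EuclideanSpace ℝ (Fin m), ℂ)).toLinearMap -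
    z ^ 2 • 1

theorem helmholtz_apply {m : ℕ} (z : ℂ) (f : 𝓢(EuclideanSpace ℝ (Fin m), ℂ)) :
    helmholtz m z f = Δ f - z ^ 2 • f := by
  simp [helmholtz]

theorem helmholtz_pow_coe {m : ℕ} (z : ℂ) (n : ℕ) (f : 𝓢(EuclideanSpace ℝ (Fin m), ℂ)) :
    (fun g : EuclideanSpace ℝ (Fin m) → ℂ => fun w => laplacianC g w - z ^ 2 * g w)^[n] f =
      ⇑((helmholtz m z ^ n) f) := by
  induction n with
  | zero => rfl
  | succ n ih =>
    rw [Function.iterate_succ_apply', ih, pow_succ' (helmholtz m z), Module.End.mul_apply,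
      helmholtz_apply]
    ext x
    simp [laplacianC_coe_schwartz]

theorem fourier_lineDerivOp_apply {m : ℕ} (f : 𝓢(EuclideanSpace ℝ (Fin m), ℂ))
    (v ξ : EuclideanSpace ℝ (Fin m)) :
    𝓕 (∂_{v} f) ξ = 2 * π * Complex.I * (inner ℝ ξ v * 𝓕 f ξ) := by
  have ht : (inner ℝ · v : EuclideanSpace ℝ (Fin m) → ℝ).HasTemperateGrowth := by fun_prop
  rw [fourier_lineDerivOp_eq, smul_apply, SchwartzMap.smulLeftCLM_apply_apply ht, smul_eq_mul,
    Complex.real_smul]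

theorem fourier_laplacian_apply {m : ℕ} (f : 𝓢(EuclideanSpace ℝ (Fin m), ℂ))
    (ξ : EuclideanSpace ℝ (Fin m)) :
    𝓕 (Δ f) ξ = -(4 * π ^ 2 * ‖ξ‖ ^ 2 : ℝ) * 𝓕 f ξ := by
  have hsum : 𝓕 (Δ f) = ∑ i : Fin m,
      𝓕 (∂_{EuclideanSpace.single i (1 : ℝ)} (∂_{EuclideanSpace.single i (1 : ℝ)} f)) := by
    rw [SchwartzMap.laplacian_eq_sum (EuclideanSpace.basisFun (Fin m) ℝ) f,
      ← fourierTransformCLM_apply (𝕜 := ℂ), map_sum]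
    simp
  rw [hsum, sum_apply, EuclideanSpace.norm_sq_eq]
  push_cast
  rw [Finset.mul_sum, ← Finset.sum_neg_distrib, Finset.sum_mul]
  refine Finset.sum_congr rfl fun i _ => ?_
  rw [fourier_lineDerivOp_apply, fourier_lineDerivOp_apply]
  simp only [EuclideanSpace.inner_single_right, conj_trivial, one_mul, Real.norm_eq_abs,
    ← Complex.ofReal_pow, sq_abs]
  push_cast
  linear_combination (4 * π ^ 2 * (ξ i) ^ 2 * 𝓕 f ξ : ℂ) * Complex.I_sq

theorem fourier_helmholtz_pow_apply {m : ℕ} (z : ℝ) (n : ℕ)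
    (f : 𝓢(EuclideanSpace ℝ (Fin m), ℂ)) (ξ : EuclideanSpace ℝ (Fin m)) :
    𝓕 ((helmholtz m z ^ n) f) ξ = (-(z ^ 2 + 4 * π ^ 2 * ‖ξ‖ ^ 2 : ℝ) : ℂ) ^ n * 𝓕 f ξ := by
  induction n with
  | zero => simp
  | succ n ih =>
    rw [pow_succ' (helmholtz m z), Module.End.mul_apply, helmholtz_apply,
      ← fourierTransformCLM_apply (𝕜 := ℂ), map_sub, map_smul]
    simp only [fourierTransformCLM_apply, sub_apply, smul_apply,
      fourier_laplacian_apply, ih, smul_eq_mul]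
    push_cast
    ring

theorem norm_exp_neg_norm_mul_le_one {E : Type*} [SeminormedAddCommGroup E] {z : ℂ}
    (hz : 0 ≤ z.re) (x : E) : ‖Complex.exp (-(‖x‖ : ℂ) * z)‖ ≤ 1 := by
  rw [Complex.norm_exp, Real.exp_le_one_iff]
  simp only [Complex.mul_re, Complex.neg_re, Complex.ofReal_re, Complex.neg_im,
    Complex.ofReal_im, neg_zero, zero_mul, sub_zero]
  nlinarith [mul_nonneg (norm_nonneg x) hz]

theorem integrable_exp_neg_norm_mul {m : ℕ} (f : 𝓢(EuclideanSpace ℝ (Fin m), ℂ))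
    {z : ℂ} (hz : 0 < z.re) :
    Integrable fun x => Complex.exp (-(‖x‖ : ℂ) * z) * f x := by
  refine f.integrable.norm.mono' (by fun_prop : Continuous _).aestronglyMeasurable
    (.of_forall fun x => ?_)
  rw [norm_mul]
  exact mul_le_of_le_one_left (norm_nonneg _) (norm_exp_neg_norm_mul_le_one hz.le x)

theorem differentiableAt_integral_exp_neg_norm_mul {m : ℕ} (f : 𝓢(EuclideanSpace ℝ (Fin m), ℂ))
    {z : ℂ} (hz : 0 < z.re) :
    DifferentiableAt ℂ (fun w : ℂ => ∫ x, Complex.exp (-(‖x‖ : ℂ) * w) * f x) z := by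
  have hs : {w : ℂ | 0 < w.re} ∈ nhds z :=
    (isOpen_lt continuous_const Complex.continuous_re).mem_nhds hz
  have hmeas : ∀ w : ℂ, AEStronglyMeasurable
      (fun x : EuclideanSpace ℝ (Fin m) => Complex.exp (-(‖x‖ : ℂ) * w) * f x) volume := by
    intro w
    exact (by fun_prop : Continuous _).aestronglyMeasurable
  refine (hasDerivAt_integral_of_dominated_loc_of_deriv_le (𝕜 := ℂ)
    (F := fun w x => Complex.exp (-(‖x‖ : ℂ) * w) * f x)
    (F' := fun w x => Complex.exp (-(‖x‖ : ℂ) * w) * (-(‖x‖ : ℂ)) * f x)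
    (bound := fun x => ‖x‖ ^ 1 * ‖f x‖) hs (.of_forall hmeas) ?_ ?_ ?_
    (f.integrable_pow_mul volume 1) ?_).2.differentiableAt
  · exact integrable_exp_neg_norm_mul f hz
  · exact (by fun_prop : Continuous _).aestronglyMeasurable
  · refine .of_forall fun x w hw => ?_
    rw [norm_mul, norm_mul, norm_neg, Complex.norm_real, norm_norm, pow_one]
    gcongr
    exact mul_le_of_le_one_left (norm_nonneg _) (norm_exp_neg_norm_mul_le_one (le_of_lt hw) x)
  · refine .of_forall fun x w _ => ?_
    simpa using (((hasDerivAt_id w).const_mul (-(‖x‖ : ℂ))).cexp).mul_const (f x)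

theorem differentiableOn_integral_helmholtz_pow {m : ℕ} (n : ℕ)
    (f : 𝓢(EuclideanSpace ℝ (Fin m), ℂ)) :
    DifferentiableOn ℂ
      (fun z : ℂ => ∫ x, Complex.exp (-(‖x‖ : ℂ) * z) * (helmholtz m z ^ n) f x)
      {z | 0 < z.re} := by
  induction n generalizing f with
  | zero =>
    exact fun z hz => (differentiableAt_integral_exp_neg_norm_mul f hz).differentiableWithinAt
  | succ n ih =>
    have h : DifferentiableOn ℂ (fun z : ℂ =>
        (∫ x, Complex.exp (-(‖x‖ : ℂ) * z) * (helmholtz m z ^ n) (Δ f) x) -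
          z ^ 2 * ∫ x, Complex.exp (-(‖x‖ : ℂ) * z) * (helmholtz m z ^ n) f x)
        {z | 0 < z.re} :=
      (ih (Δ f)).sub ((differentiableOn_id.pow 2).mul (ih f))
    refine h.congr fun z hz => ?_
    rw [← integral_const_mul, ← integral_sub (integrable_exp_neg_norm_mul _ hz)
      ((integrable_exp_neg_norm_mul _ hz).const_mul _)]
    refine integral_congr_ae (.of_forall fun x => ?_)
    simp only [pow_succ (helmholtz m z), Module.End.mul_apply, helmholtz_apply, map_sub, map_smul,
      sub_apply, smul_apply, smul_eq_mul]
    ring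

/-- The Cauchy–Schlömilch substitution applied to the Gaussian integral. -/
theorem integral_exp_neg_mul_sub_div_sq {z b : ℝ} (hz : 0 < z) (hb : 0 < b) :
    ∫ s in Set.Ioi (0 : ℝ), exp (-(z * s - b / s) ^ 2) = √π / (2 * z) := by
  set f : ℝ → ℝ := fun s => z * s - b / s with hf
  have hder : ∀ s ∈ Set.Ioi (0 : ℝ), HasDerivWithinAt f (z + b / s ^ 2) (Set.Ioi 0) s := by
    intro s hs
    have hs' : s ≠ 0 := ne_of_gt hs
    have h := ((hasDerivAt_id s).const_mul z).sub ((hasDerivAt_inv hs').const_mul b)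
    refine (h.congr_deriv ?_).hasDerivWithinAt
    field_simp
    ring
  have hmono : StrictMonoOn f (Set.Ioi 0) := by
    intro s hs t ht hst
    have h1 : b / t < b / s := div_lt_div_of_pos_left hb hs hst
    have h2 : z * s < z * t := mul_lt_mul_of_pos_left hst hz
    simp only [hf]; linarith
  have himg : f '' Set.Ioi 0 = Set.univ := by
    refine Set.eq_univ_of_forall fun y => ?_
    have hq : |y| < √(y ^ 2 + 4 * z * b) := by
      rw [← Real.sqrt_sq_eq_abs]
      exact Real.sqrt_lt_sqrt (sq_nonneg y) (by nlinarith [mul_pos hz hb])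
    have hp : 0 < y + √(y ^ 2 + 4 * z * b) := by linarith [neg_abs_le y]
    have hsq : √(y ^ 2 + 4 * z * b) ^ 2 = y ^ 2 + 4 * z * b :=
      Real.sq_sqrt (by nlinarith [mul_pos hz hb, sq_nonneg y])
    refine ⟨(y + √(y ^ 2 + 4 * z * b)) / (2 * z), by simp only [Set.mem_Ioi]; positivity, ?_⟩
    simp only [hf]
    generalize √(y ^ 2 + 4 * z * b) = q at hp hsq
    field_simp
    linear_combination hsq
  have hgi : Integrable fun x : ℝ => exp (-x ^ 2) := by
    simpa using integrable_exp_neg_mul_sq (b := 1) one_pos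
  have hg : ∫ x : ℝ, exp (-x ^ 2) = √π := by simpa using integral_gaussian 1
  have hint : IntegrableOn (fun s => |z + b / s ^ 2| • exp (-f s ^ 2)) (Set.Ioi 0) :=
    (integrableOn_image_iff_integrableOn_abs_deriv_smul measurableSet_Ioi hder hmono.injOn
      (fun x => exp (-x ^ 2))).1 (by rw [himg]; exact hgi.integrableOn)
  have hval : ∫ s in Set.Ioi (0 : ℝ), |z + b / s ^ 2| • exp (-f s ^ 2) = √π := by
    rw [← integral_image_eq_integral_abs_deriv_smul measurableSet_Ioi hder hmono.injOn
      (fun x => exp (-x ^ 2)), himg, setIntegral_univ, hg]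
  have hmeas : Measurable f := by fun_prop
  have hi1 : IntegrableOn (fun s => z * exp (-f s ^ 2)) (Set.Ioi 0) := by
    refine Integrable.mono' hint (by fun_prop) ?_
    refine (ae_restrict_iff' measurableSet_Ioi).2 (.of_forall fun s hs => ?_)
    have : 0 ≤ b / s ^ 2 := by positivity
    rw [smul_eq_mul, abs_of_pos (by linarith), norm_of_nonneg (by positivity)]
    gcongr
    linarith
  have hi2 : IntegrableOn (fun s => b / s ^ 2 * exp (-f s ^ 2)) (Set.Ioi 0) := by
    refine Integrable.mono' hint (by fun_prop) ?_
    refine (ae_restrict_iff' measurableSet_Ioi).2 (.of_forall fun s hs => ?_)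
    have : 0 ≤ b / s ^ 2 := by positivity
    rw [smul_eq_mul, abs_of_pos (by linarith), norm_of_nonneg (by positivity)]
    gcongr
    linarith
  have hsplit : (∫ s in Set.Ioi (0 : ℝ), z * exp (-f s ^ 2)) +
      ∫ s in Set.Ioi (0 : ℝ), b / s ^ 2 * exp (-f s ^ 2) = √π := by
    rw [← hval, ← integral_add hi1 hi2]
    refine setIntegral_congr_fun measurableSet_Ioi fun s hs => ?_
    have : 0 ≤ b / s ^ 2 := by positivity
    simp only [smul_eq_mul]
    rw [abs_of_pos (by linarith)]
    ring
  have hinv : ∫ s in Set.Ioi (0 : ℝ), z * exp (-f s ^ 2) =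
      ∫ s in Set.Ioi (0 : ℝ), b / s ^ 2 * exp (-f s ^ 2) := by
    set g : ℝ → ℝ := fun s => b / z * s⁻¹ with hgdef
    have hgd : ∀ s ∈ Set.Ioi (0 : ℝ),
        HasDerivWithinAt g (b / z * (-(s ^ 2)⁻¹)) (Set.Ioi 0) s := fun s hs =>
      ((hasDerivAt_inv (ne_of_gt hs)).const_mul (b / z)).hasDerivWithinAt
    have hbz : 0 < b / z := by positivity
    have hginj : Set.InjOn g (Set.Ioi 0) := by
      intro s _ t _ hst
      exact inv_injective (mul_left_cancel₀ hbz.ne' hst)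
    have hgimg : g '' Set.Ioi 0 = Set.Ioi 0 := by
      ext y
      constructor
      · rintro ⟨s, hs, rfl⟩
        have hs : 0 < s := hs
        simp only [hgdef, Set.mem_Ioi]; positivity
      · intro hy
        have hy : 0 < y := hy
        refine ⟨b / z * y⁻¹, by simp only [Set.mem_Ioi]; positivity, ?_⟩
        simp only [hgdef]; field_simp
    have h := integral_image_eq_integral_abs_deriv_smul measurableSet_Ioi hgd hginj
      (fun s => z * exp (-f s ^ 2))
    rw [hgimg] at h
    rw [h]
    refine setIntegral_congr_fun measurableSet_Ioi fun s hs => ?_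
    have hs : 0 < s := hs
    have hfg : f (g s) = -f s := by
      simp only [hf, hgdef]; field_simp; ring
    simp only [smul_eq_mul, hfg, neg_sq]
    rw [mul_neg, abs_neg, abs_of_pos (by positivity)]
    field_simp
  rw [← hinv, integral_const_mul] at hsplit
  rw [eq_div_iff (by positivity)]
  linarith

/-- Subordination: `exp (-2 * b * z)` as a superposition of Gaussians in `b`. -/
theorem integral_exp_neg_sq_sub_div_sq {z b : ℝ} (hz : 0 < z) (hb : 0 ≤ b) :
    ∫ s in Set.Ioi (0 : ℝ), exp (-(z * s) ^ 2 - (b / s) ^ 2) =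
      √π / (2 * z) * exp (-(2 * b * z)) := by
  rcases hb.eq_or_lt with rfl | hb
  · have h := integral_gaussian_Ioi (z ^ 2)
    rw [Real.sqrt_div pi_pos.le, Real.sqrt_sq hz.le] at h
    simp only [zero_div, mul_pow, ne_eq, OfNat.ofNat_ne_zero, not_false_eq_true, zero_pow, sub_zero,
      mul_zero, zero_mul, neg_zero, exp_zero, mul_one, ← neg_mul]
    rw [h]
    field_simp
  · rw [← integral_exp_neg_mul_sub_div_sq hz hb, ← integral_mul_const]
    refine setIntegral_congr_fun measurableSet_Ioi fun s hs => ?_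
    have hs : 0 < s := hs
    simp only [← Real.exp_add]
    congr 1
    field_simp
    ring

/-- Parseval's formula for a Gaussian against a Schwartz function. -/
theorem integral_gaussian_mul_schwartz {m : ℕ} {s : ℝ} (hs : 0 < s)
    (f : 𝓢(EuclideanSpace ℝ (Fin m), ℂ)) :
    ∫ x, ((exp (-(‖x‖ / 2 / s) ^ 2) : ℝ) : ℂ) * f x =
      (((2 * √π * s) ^ m : ℝ) : ℂ) *
        ∫ ξ, ((exp (-(4 * π ^ 2 * ‖ξ‖ ^ 2) * s ^ 2) : ℝ) : ℂ) * 𝓕 f ξ := by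
  set b : ℝ := 4 * π ^ 2 * s ^ 2 with hb
  have hb0 : 0 < (b : ℂ).re := by rw [Complex.ofReal_re]; positivity
  have hG : Integrable fun v : EuclideanSpace ℝ (Fin m) => Complex.exp (-(b : ℂ) * ‖v‖ ^ 2) := by
    simpa using GaussianFourier.integrable_cexp_neg_mul_sq_norm_add hb0 0
      (0 : EuclideanSpace ℝ (Fin m))
  have hflip : ∫ x, 𝓕 (fun v : EuclideanSpace ℝ (Fin m) => Complex.exp (-(b : ℂ) * ‖v‖ ^ 2)) x *
      f x = ∫ ξ, Complex.exp (-(b : ℂ) * ‖ξ‖ ^ 2) * 𝓕 f ξ := by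
    simpa using! VectorFourier.integral_fourierIntegral_smul_eq_flip
      (L := innerₗ (EuclideanSpace ℝ (Fin m))) continuous_fourierChar continuous_inner hG
      f.integrable
  have hconst : ((π : ℂ) / b) ^ (Module.finrank ℝ (EuclideanSpace ℝ (Fin m)) / 2 : ℂ) =
      ((((2 * √π * s) ^ m)⁻¹ : ℝ) : ℂ) := by
    have hc : 0 < 2 * √π * s := by positivity
    have h1 : π / b = ((2 * √π * s)⁻¹) ^ 2 := by
      rw [inv_pow, mul_pow, mul_pow, Real.sq_sqrt pi_pos.le, hb]
      field_simp
      norm_num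
    have h2 : (Module.finrank ℝ (EuclideanSpace ℝ (Fin m)) / 2 : ℂ) = ((m / 2 : ℝ) : ℂ) := by
      simp
    rw [h2, ← Complex.ofReal_div, ← Complex.ofReal_cpow (by positivity), h1,
      ← Real.rpow_natCast, ← Real.rpow_mul (by positivity), Nat.cast_ofNat,
      mul_div_cancel₀ _ two_ne_zero, Real.rpow_natCast, inv_pow]
  have hc : (((2 * √π * s) ^ m : ℝ) : ℂ) ≠ 0 := by
    rw [Complex.ofReal_ne_zero]; positivity
  have hR : ∫ ξ, ((exp (-(4 * π ^ 2 * ‖ξ‖ ^ 2) * s ^ 2) : ℝ) : ℂ) * 𝓕 f ξ =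
      ∫ ξ, Complex.exp (-(b : ℂ) * ‖ξ‖ ^ 2) * 𝓕 f ξ := by
    refine integral_congr_ae (.of_forall fun ξ => ?_)
    simp only [hb]
    push_cast
    ring_nf
  rw [hR, ← hflip, ← integral_const_mul]
  refine integral_congr_ae (.of_forall fun x => ?_)
  simp only
  rw [fourier_gaussian_innerProductSpace hb0, hconst, ← mul_assoc, ← mul_assoc, Complex.ofReal_inv,
    mul_inv_cancel₀ hc, one_mul, Complex.ofReal_exp]
  congr 2
  rw [hb]
  push_cast
  have h1 : (s : ℂ) ≠ 0 := Complex.ofReal_ne_zero.2 hs.ne'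
  have h2 : (π : ℂ) ≠ 0 := Complex.ofReal_ne_zero.2 pi_ne_zero
  field_simp
  norm_num

theorem integral_pow_mul_exp_neg_mul_sq (k : ℕ) {A : ℝ} (hA : 0 < A) :
    ∫ s in Set.Ioi (0 : ℝ), s ^ (2 * k + 1) * exp (-A * s ^ 2) =
      (k.factorial : ℝ) / (2 * A ^ (k + 1)) := by
  have h := integral_rpow_mul_exp_neg_mul_rpow (p := 2) (q := (2 * k + 1 : ℕ)) two_pos
    (by linarith [Nat.cast_nonneg (α := ℝ) (2 * k + 1)]) hA
  simp only [Real.rpow_natCast, Real.rpow_two] at h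
  rw [h]
  have h1 : (((2 * k + 1 : ℕ) : ℝ) + 1) / 2 = (k : ℝ) + 1 := by push_cast; ring
  rw [neg_div, h1, Real.Gamma_nat_eq_factorial, Real.rpow_neg hA.le]
  norm_cast
  field_simp

/-- The Fourier transform of `exp (-z‖x‖)` in odd dimension, tested against Schwartz functions. -/
theorem integral_exp_neg_norm_mul_schwartz {k : ℕ} {z : ℝ} (hz : 0 < z)
    (f : 𝓢(EuclideanSpace ℝ (Fin (2 * k + 1)), ℂ)) :
    ∫ x, Complex.exp (-(‖x‖ : ℂ) * z) * f x =
      ((2 ^ (2 * k + 1) * π ^ k * k.factorial * z : ℝ) : ℂ) *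
        ∫ ξ, (((z ^ 2 + 4 * π ^ 2 * ‖ξ‖ ^ 2) ^ (k + 1) : ℝ) : ℂ)⁻¹ * 𝓕 f ξ := by
  have hsub : ∀ x : EuclideanSpace ℝ (Fin (2 * k + 1)),
      Complex.exp (-(‖x‖ : ℂ) * z) * f x = ((2 * z / √π : ℝ) : ℂ) *
        ∫ s in Set.Ioi (0 : ℝ), ((exp (-(z * s) ^ 2 - (‖x‖ / 2 / s) ^ 2) : ℝ) : ℂ) * f x := by
    intro x
    rw [integral_mul_const, integral_complex_ofReal,
      integral_exp_neg_sq_sub_div_sq hz (by positivity), ← mul_assoc, ← Complex.ofReal_mul,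
      ← mul_assoc, div_mul_div_cancel₀ (by positivity), div_self (by positivity), one_mul]
    push_cast
    ring_nf
  have hexp : Integrable (fun s : ℝ => exp (-z ^ 2 * s ^ 2)) (volume.restrict (Set.Ioi 0)) :=
    (integrable_exp_neg_mul_sq (by positivity)).integrableOn
  have hswap1 : Integrable (Function.uncurry fun (x : EuclideanSpace ℝ (Fin (2 * k + 1))) (s : ℝ) =>
      ((exp (-(z * s) ^ 2 - (‖x‖ / 2 / s) ^ 2) : ℝ) : ℂ) * f x)
      (volume.prod (volume.restrict (Set.Ioi 0))) := by
    refine (f.integrable.norm.mul_prod hexp).mono' ?_ (.of_forall fun p => ?_)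
    · have hf : Measurable f := f.continuous.measurable
      exact Measurable.aestronglyMeasurable (by unfold Function.uncurry; fun_prop)
    · simp only [Function.uncurry]
      rw [norm_mul, Complex.norm_real, norm_of_nonneg (exp_pos _).le, mul_comm]
      gcongr
      nlinarith [sq_nonneg (‖p.1‖ / 2 / p.2)]
  have hpow : Integrable (fun s : ℝ => s ^ (2 * k + 1) * exp (-z ^ 2 * s ^ 2))
      (volume.restrict (Set.Ioi 0)) := by
    have h := integrableOn_rpow_mul_exp_neg_mul_sq (b := z ^ 2) (by positivity)
      (s := (2 * k + 1 : ℕ)) (by linarith [Nat.cast_nonneg (α := ℝ) (2 * k + 1)])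
    simp only [Real.rpow_natCast] at h
    exact h
  have hswap2 : Integrable (Function.uncurry fun (s : ℝ) (ξ : EuclideanSpace ℝ (Fin (2 * k + 1))) =>
      ((s ^ (2 * k + 1) * exp (-(z ^ 2 + 4 * π ^ 2 * ‖ξ‖ ^ 2) * s ^ 2) : ℝ) : ℂ) * 𝓕 f ξ)
      ((volume.restrict (Set.Ioi 0)).prod volume) := by
    refine (hpow.norm.mul_prod (𝓕 f).integrable.norm).mono' ?_ (.of_forall fun p => ?_)
    · have hf : Measurable ((𝓕 f : 𝓢(EuclideanSpace ℝ (Fin (2 * k + 1)), ℂ)) :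
        EuclideanSpace ℝ (Fin (2 * k + 1)) → ℂ) :=
        (𝓕 f).continuous.measurable
      exact Measurable.aestronglyMeasurable (by unfold Function.uncurry; fun_prop)
    · simp only [Function.uncurry]
      rw [norm_mul, Complex.norm_real, norm_mul, norm_mul, norm_of_nonneg (exp_pos _).le,
        norm_of_nonneg (exp_pos _).le]
      gcongr
      nlinarith [sq_nonneg (2 * π * ‖p.2‖ * p.1)]
  simp_rw [hsub]
  rw [integral_const_mul, integral_integral_swap hswap1]
  have hinner : ∀ s ∈ Set.Ioi (0 : ℝ),
      ∫ x, ((exp (-(z * s) ^ 2 - (‖x‖ / 2 / s) ^ 2) : ℝ) : ℂ) * f x =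
      (((2 * √π) ^ (2 * k + 1) : ℝ) : ℂ) * ∫ ξ,
        ((s ^ (2 * k + 1) * exp (-(z ^ 2 + 4 * π ^ 2 * ‖ξ‖ ^ 2) * s ^ 2) : ℝ) : ℂ) * 𝓕 f ξ := by
    intro s hs
    have h1 : ∫ x, ((exp (-(z * s) ^ 2 - (‖x‖ / 2 / s) ^ 2) : ℝ) : ℂ) * f x =
        ((exp (-(z * s) ^ 2) : ℝ) : ℂ) * ∫ x, ((exp (-(‖x‖ / 2 / s) ^ 2) : ℝ) : ℂ) * f x := by
      rw [← integral_const_mul]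
      refine integral_congr_ae (.of_forall fun x => ?_)
      simp only
      rw [← mul_assoc, ← Complex.ofReal_mul, ← Real.exp_add, sub_eq_add_neg]
    rw [h1, integral_gaussian_mul_schwartz hs, ← integral_const_mul, ← integral_const_mul,
      ← integral_const_mul]
    refine integral_congr_ae (.of_forall fun ξ => ?_)
    simp only
    rw [neg_add, add_mul, Real.exp_add, mul_pow (2 * √π), mul_pow z, neg_mul]
    push_cast
    ring_nf
  rw [setIntegral_congr_fun measurableSet_Ioi hinner, integral_const_mul,
    integral_integral_swap hswap2, ← mul_assoc, ← integral_const_mul, ← integral_const_mul]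
  refine integral_congr_ae (.of_forall fun ξ => ?_)
  simp only
  rw [integral_mul_const, integral_complex_ofReal,
    integral_pow_mul_exp_neg_mul_sq k (by positivity), ← mul_assoc, ← mul_assoc,
    ← Complex.ofReal_inv, ← Complex.ofReal_mul, ← Complex.ofReal_mul, ← Complex.ofReal_mul]
  congr 2
  have h : √π ^ (2 * k + 1) = π ^ k * √π := by
    rw [pow_succ, pow_mul, Real.sq_sqrt pi_pos.le]
  rw [mul_pow, h]
  field_simp

theorem integral_exp_neg_norm_mul_helmholtz_of_real {k : ℕ} {z : ℝ} (hz : 0 < z)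
    (f : 𝓢(EuclideanSpace ℝ (Fin (2 * k + 1)), ℂ)) :
    ∫ x, Complex.exp (-(‖x‖ : ℂ) * z) * (helmholtz (2 * k + 1) z ^ (k + 1)) f x =
      (-1) ^ (k + 1) * (2 ^ (2 * k + 1) * π ^ k * k.factorial) * z * f 0 := by
  have hf : f 0 = ∫ ξ, 𝓕 f ξ := by
    conv_lhs => rw [← fourierInv_fourier_eq (F := 𝓢(EuclideanSpace ℝ (Fin (2 * k + 1)), ℂ)) f,
      fourierInv_coe, Real.fourierInv_eq]
    simp
  rw [integral_exp_neg_norm_mul_schwartz hz, hf, ← integral_const_mul, ← integral_const_mul]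
  refine integral_congr_ae (.of_forall fun ξ => ?_)
  simp only
  have hA : ((z ^ 2 + 4 * π ^ 2 * ‖ξ‖ ^ 2 : ℝ) : ℂ) ≠ 0 := by
    rw [Complex.ofReal_ne_zero]; positivity
  rw [fourier_helmholtz_pow_apply, neg_pow, Complex.ofReal_pow]
  generalize ((z ^ 2 + 4 * π ^ 2 * ‖ξ‖ ^ 2 : ℝ) : ℂ) = A at hA
  push_cast
  field_simp

theorem integral_exp_neg_norm_mul_helmholtz {k : ℕ} {z : ℂ} (hz : 0 < z.re)
    (f : 𝓢(EuclideanSpace ℝ (Fin (2 * k + 1)), ℂ)) :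
    ∫ x, Complex.exp (-(‖x‖ : ℂ) * z) * (helmholtz (2 * k + 1) z ^ (k + 1)) f x =
      (-1) ^ (k + 1) * (2 ^ (2 * k + 1) * π ^ k * k.factorial) * z * f 0 := by
  have hopen : IsOpen {w : ℂ | 0 < w.re} := isOpen_lt continuous_const Complex.continuous_re
  have hR : DifferentiableOn ℂ (fun w : ℂ =>
      (-1) ^ (k + 1) * (2 ^ (2 * k + 1) * (π : ℂ) ^ k * k.factorial) * w * f 0)
      {w | 0 < w.re} := by fun_prop
  refine AnalyticOnNhd.eqOn_of_preconnected_of_frequently_eq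
    ((differentiableOn_integral_helmholtz_pow (k + 1) f).analyticOnNhd hopen)
    (hR.analyticOnNhd hopen) (convex_halfSpace_re_gt 0).isPreconnected (z₀ := 1)
    (by simp) ?_ hz
  have htend : Filter.Tendsto (fun t : ℝ => (t : ℂ)) (nhdsWithin 1 (Set.Ioi 1))
      (nhdsWithin 1 {1}ᶜ) := by
    refine tendsto_nhdsWithin_iff.2 ⟨?_, ?_⟩
    · exact (Complex.continuous_ofReal.tendsto' 1 1 Complex.ofReal_one).mono_left nhdsWithin_le_nhds
    · filter_upwards [self_mem_nhdsWithin] with t ht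
      simpa using ne_of_gt ht
  refine htend.frequently (Filter.Eventually.frequently ?_)
  filter_upwards [self_mem_nhdsWithin] with t ht
  exact integral_exp_neg_norm_mul_helmholtz_of_real (one_pos.trans ht) f

/-- For odd `m`, `ν = (m+1)/2`, and `Re z > 0`, the function
`u(x) = (−1)^ν (2π)^{−m} (π^{(m+1)/2}/((m−1)/2)!) e^{−‖x‖z}/z` is a fundamental solution of
`(Δ − z²)^ν` on ℝᵐ: pairing `u` against `(Δ − z²)^ν φ` recovers `φ(0)` for every Schwartz
function `φ`. -/
theorem fundamental_solution_odd_dim (m : ℕ) (hm : 1 ≤ m) (hodd : Odd m)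
    (z : ℂ) (hz : 0 < z.re) (ν : ℕ) (hν : ν = (m + 1) / 2)
    (u : EuclideanSpace ℝ (Fin m) → ℂ)
    (hu : ∀ x, u x =
      (-1) ^ ν * ((2 * π : ℝ) : ℂ) ^ (-(m : ℤ)) *
        ((π : ℂ) ^ ((m + 1) / 2) / (Nat.factorial ((m - 1) / 2) : ℂ)) *
        Complex.exp (-(‖x‖ : ℂ) * z) / z) :
    ∀ φ : SchwartzMap (EuclideanSpace ℝ (Fin m)) ℂ,
      ∫ x : EuclideanSpace ℝ (Fin m),
        u x * ((fun f : EuclideanSpace ℝ (Fin m) → ℂ => fun w => laplacianC f w - z ^ 2 * f w)^[ν]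
          (⇑φ)) x = φ 0 := by
  intro φ
  obtain ⟨k, rfl⟩ := hodd
  have h1 : (2 * k + 1 + 1) / 2 = k + 1 := by omega
  have h2 : (2 * k + 1 - 1) / 2 = k := by omega
  rw [h1] at hν
  subst hν
  rw [helmholtz_pow_coe]
  have hz0 : z ≠ 0 := by rintro rfl; simp at hz
  have hcongr : ∀ x, u x * (helmholtz (2 * k + 1) z ^ (k + 1)) φ x =
      ((-1) ^ (k + 1) * ((2 * π : ℝ) : ℂ) ^ (-((2 * k + 1 : ℕ) : ℤ)) *
        ((π : ℂ) ^ (k + 1) / (k.factorial : ℂ)) / z) *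
      (Complex.exp (-(‖x‖ : ℂ) * z) * (helmholtz (2 * k + 1) z ^ (k + 1)) φ x) := by
    intro x
    rw [hu, h1, h2]
    ring
  simp_rw [hcongr]
  rw [integral_const_mul, integral_exp_neg_norm_mul_helmholtz hz, zpow_neg, zpow_natCast]
  have hπ : (π : ℂ) ≠ 0 := Complex.ofReal_ne_zero.2 pi_ne_zero
  have hk : (k.factorial : ℂ) ≠ 0 := Nat.cast_ne_zero.2 k.factorial_ne_zero
  have hsign : ((-1 : ℂ) ^ (k + 1)) * (-1) ^ (k + 1) = 1 := by
    rw [← mul_pow]; simp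
  push_cast
  rw [mul_pow]
  field_simp
  linear_combination (π ^ (2 * k + 1) * φ 0) * hsign
end

section
/- Let n ≥ 1 and let α₁, …, α_d be vectors in ℝⁿ such that the polynomial P(λ) = ∏_{i=1}^{d} ⟨αᵢ, λ⟩ is harmonic (ΔP = 0 identically). Then for every y ∈ ℝⁿ, ∫_{ℝⁿ} e^{−‖λ‖²} P(λ) e^{−i⟨λ, y⟩} dλ = (−i)^d · 2^{−d} · π^{n/2} · P(y) · e^{−‖y‖²/4}. -/
open scoped RealInnerProductSpace
open Real MeasureTheory

open MvPolynomial

theorem MvPolynomial.pderiv_comm {σ R : Type*} [CommRing R] (i j : σ) (p : MvPolynomial σ R) :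
    pderiv i (pderiv j p) = pderiv j (pderiv i p) := by
  classical
  let D : Derivation R (MvPolynomial σ R) (MvPolynomial σ R) :=
    ⁅(pderiv i : Derivation R (MvPolynomial σ R) _), (pderiv j : Derivation R (MvPolynomial σ R) _)⁆
  have hD : D = 0 := derivation_ext fun k => by
    simp [D, Derivation.commutator_apply, pderiv_X, Pi.single_apply, apply_ite]
  exact sub_eq_zero.mp ((Derivation.commutator_apply p).symm.trans (DFunLike.congr_fun hD p))

theorem MvPolynomial.hasLineDerivAt_eval_single {n : ℕ} (p : MvPolynomial (Fin n) ℝ) (j : Fin n)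
    (x : EuclideanSpace ℝ (Fin n)) :
    HasLineDerivAt ℝ (fun x : EuclideanSpace ℝ (Fin n) => eval x p) (eval x (pderiv j p)) x
      (EuclideanSpace.single j 1) := by
  unfold HasLineDerivAt
  induction p using MvPolynomial.induction_on with
  | C a => simpa using hasDerivAt_const (0 : ℝ) a
  | add p q hp hq =>
    simp only [map_add]
    exact hp.add hq
  | mul_X p i hp =>
    have hX : HasDerivAt (fun t : ℝ => (x + t • EuclideanSpace.single j (1 : ℝ)) i)
        (eval x (pderiv j (X i))) 0 := by
      have h := ((hasDerivAt_id (0 : ℝ)).mul_const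
        ((EuclideanSpace.single j (1 : ℝ) : EuclideanSpace ℝ (Fin n)) i)).const_add (x i)
      convert! h using 1
      simp [pderiv_X, Pi.single_apply, eq_comm, apply_ite]
    have h := hp.mul hX
    simp only [zero_smul, add_zero] at h
    simp only [Derivation.leibniz, smul_eq_mul, map_add, map_mul, eval_X]
    convert! h using 1
    ring

theorem MvPolynomial.differentiable_eval {n : ℕ} (p : MvPolynomial (Fin n) ℝ) :
    Differentiable ℝ (fun x : EuclideanSpace ℝ (Fin n) => eval x p) := by
  induction p using MvPolynomial.induction_on with
  | C a => simp
  | add p q hp hq =>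
    simp only [map_add]
    exact hp.add hq
  | mul_X p i hp =>
    simp only [map_mul, eval_X]
    fun_prop

theorem MvPolynomial.laplacian_eval {n : ℕ} (p : MvPolynomial (Fin n) ℝ)
    (x : EuclideanSpace ℝ (Fin n)) :
    laplacian (fun x : EuclideanSpace ℝ (Fin n) => eval x p) x =
      eval x (∑ j, pderiv j (pderiv j p)) := by
  have key (q : MvPolynomial (Fin n) ℝ) (j : Fin n) (z : EuclideanSpace ℝ (Fin n)) :
      fderiv ℝ (fun x : EuclideanSpace ℝ (Fin n) => eval x q) z (EuclideanSpace.single j 1) =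
        eval z (pderiv j q) := by
    rw [← (q.differentiable_eval z).lineDeriv_eq_fderiv]
    exact (q.hasLineDerivAt_eval_single j z).lineDeriv
  simp only [laplacian, key, map_sum]

theorem MvPolynomial.integrable_eval_mul_exp_neg_mul_sq_norm {n : ℕ}
    (p : MvPolynomial (Fin n) ℝ) {b : ℝ} (hb : 0 < b) :
    Integrable (fun x : EuclideanSpace ℝ (Fin n) => eval x p * Real.exp (-b * ‖x‖ ^ 2)) := by
  induction p using MvPolynomial.induction_on generalizing b with
  | C a =>
    have h := (GaussianFourier.integrable_cexp_neg_mul_sq_norm_add (V := EuclideanSpace ℝ (Fin n))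
      (b := (b : ℂ)) (by simpa using hb) 0 0).re.const_mul a
    convert h using 2 with x
    simp only [eval_C]
    congr 1
    rw [show -(b : ℂ) * (‖x‖ : ℂ) ^ 2 + 0 * ((inner ℝ (0 : EuclideanSpace ℝ (Fin n)) x : ℝ) : ℂ) =
      ((-b * ‖x‖ ^ 2 : ℝ) : ℂ) by push_cast; ring, ← Complex.ofReal_exp]
    exact (Complex.ofReal_re _).symm
  | add p q hp hq =>
    simp only [map_add, add_mul]
    exact (hp hb).add (hq hb)
  | mul_X p i hp =>
    refine ((hp (half_pos hb)).const_mul (1 + 2 / b)).mono ?_ (.of_forall fun x => ?_)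
    · have h := (p * X i).differentiable_eval.continuous
      exact (h.mul (by fun_prop)).aestronglyMeasurable
    · have hx : |x i| ≤ ‖x‖ := PiLp.norm_apply_le x i
      have hexp : b / 2 * ‖x‖ ^ 2 + 1 ≤ Real.exp (b / 2 * ‖x‖ ^ 2) := Real.add_one_le_exp _
      have hle : |x i| ≤ (1 + 2 / b) * Real.exp (b / 2 * ‖x‖ ^ 2) := by
        have h1 : (1 + 2 / b) * (b / 2 * ‖x‖ ^ 2 + 1) =
            1 + ‖x‖ ^ 2 + b / 2 * ‖x‖ ^ 2 + 2 / b := by field_simp; ring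
        have h2 : (1 + 2 / b) * (b / 2 * ‖x‖ ^ 2 + 1) ≤
          (1 + 2 / b) * Real.exp (b / 2 * ‖x‖ ^ 2) := by gcongr
        have h3 : 0 ≤ b / 2 * ‖x‖ ^ 2 := by positivity
        have h4 : 0 ≤ 2 / b := by positivity
        nlinarith [sq_nonneg (‖x‖ - 1)]
      have hsplit : Real.exp (-(b / 2) * ‖x‖ ^ 2) =
          Real.exp (b / 2 * ‖x‖ ^ 2) * Real.exp (-b * ‖x‖ ^ 2) := by
        rw [← Real.exp_add]; ring_nf
      have hpos : 0 ≤ 1 + 2 / b := by positivity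
      simp only [map_mul, eval_X, norm_mul, Real.norm_eq_abs, Real.abs_exp, abs_of_nonneg hpos,
        hsplit]
      calc |eval x p| * |x i| * Real.exp (-b * ‖x‖ ^ 2)
          ≤ |eval x p| * ((1 + 2 / b) * Real.exp (b / 2 * ‖x‖ ^ 2)) *
              Real.exp (-b * ‖x‖ ^ 2) := by gcongr
        _ = _ := by ring

/-- The function `e^{−‖x‖²} e^{−i⟨x,y⟩}` integrated against polynomials in Hecke's identity. -/
noncomputable def gaussianWave {n : ℕ} (y x : EuclideanSpace ℝ (Fin n)) : ℂ :=
  Complex.exp (-(‖x‖ : ℂ) ^ 2) * Complex.exp (-(Complex.I * (⟪x, y⟫ : ℝ)))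

theorem continuous_gaussianWave {n : ℕ} (y : EuclideanSpace ℝ (Fin n)) :
    Continuous (gaussianWave y) := by
  unfold gaussianWave
  fun_prop

theorem norm_gaussianWave {n : ℕ} (y x : EuclideanSpace ℝ (Fin n)) :
    ‖gaussianWave y x‖ = Real.exp (-‖x‖ ^ 2) := by
  simp [gaussianWave, Complex.norm_exp, ← Complex.ofReal_pow]

theorem integrable_eval_mul_gaussianWave {n : ℕ} (p : MvPolynomial (Fin n) ℝ)
    (y : EuclideanSpace ℝ (Fin n)) :
    Integrable (fun x : EuclideanSpace ℝ (Fin n) => ((eval x p : ℝ) : ℂ) * gaussianWave y x) := by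
  refine (p.integrable_eval_mul_exp_neg_mul_sq_norm one_pos).mono ?_ (.of_forall fun x => ?_)
  · exact ((Complex.continuous_ofReal.comp p.differentiable_eval.continuous).mul
      (continuous_gaussianWave y)).aestronglyMeasurable
  · simp [norm_gaussianWave]

theorem hasLineDerivAt_gaussianWave {n : ℕ} (y x : EuclideanSpace ℝ (Fin n)) (j : Fin n) :
    HasLineDerivAt ℝ (gaussianWave y) ((-2 * (x j : ℂ) - Complex.I * (y j : ℂ)) * gaussianWave y x)
      x (EuclideanSpace.single j 1) := by
  have hline (t : ℝ) : gaussianWave y (x + t • EuclideanSpace.single j 1) =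
      Complex.exp (-((‖x‖ : ℂ) ^ 2 + 2 * t * x j + t * t) -
        Complex.I * ((⟪x, y⟫ : ℝ) + t * y j)) := by
    have h1 : ‖x + t • EuclideanSpace.single j (1 : ℝ)‖ ^ 2 = ‖x‖ ^ 2 + 2 * t * x j + t * t := by
      rw [norm_add_sq_real, inner_smul_right, norm_smul]
      simp [EuclideanSpace.inner_single_right]
      ring
    have h2 : ⟪x + t • EuclideanSpace.single j (1 : ℝ), y⟫ = ⟪x, y⟫ + t * y j := by
      rw [inner_add_left, real_inner_smul_left]
      simp [EuclideanSpace.inner_single_left]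
    rw [gaussianWave, ← Complex.exp_add, ← Complex.ofReal_pow, h1, h2]
    push_cast
    ring_nf
  have ht : HasDerivAt (fun t : ℝ => (t : ℂ)) 1 0 := Complex.ofRealCLM.hasDerivAt
  have h := (((((ht.const_mul 2).mul_const (x j : ℂ)).const_add ((‖x‖ : ℂ) ^ 2)).add
    (ht.mul ht)).neg.sub
    (((ht.mul_const (y j : ℂ)).const_add ((⟪x, y⟫ : ℝ) : ℂ)).const_mul Complex.I)).cexp
  unfold HasLineDerivAt
  have hx := hline 0
  simp only [zero_smul, add_zero] at hx
  rw [hx]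
  convert! h using 1
  · exact funext hline
  · simp
    ring

/-- Multiplication by a coordinate under the Gaussian-weighted Fourier integral. -/
theorem integral_eval_X_mul_gaussianWave {n : ℕ} (p : MvPolynomial (Fin n) ℝ) (j : Fin n)
    (y : EuclideanSpace ℝ (Fin n)) :
    ∫ x : EuclideanSpace ℝ (Fin n), ((eval x (X j * p) : ℝ) : ℂ) * gaussianWave y x =
      (1 / 2) * (∫ x : EuclideanSpace ℝ (Fin n), ((eval x (pderiv j p) : ℝ) : ℂ) * gaussianWave y x)
      - Complex.I / 2 * y j *
        ∫ x : EuclideanSpace ℝ (Fin n), ((eval x p : ℝ) : ℂ) * gaussianWave y x := by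
  have hp := integrable_eval_mul_gaussianWave p y
  have hX := integrable_eval_mul_gaussianWave (X j * p) y
  have hsplit (x : EuclideanSpace ℝ (Fin n)) : ((eval x p : ℝ) : ℂ) *
      ((-2 * (x j : ℂ) - Complex.I * (y j : ℂ)) * gaussianWave y x) =
      (-2) * (((eval x (X j * p) : ℝ) : ℂ) * gaussianWave y x) -
        (Complex.I * y j) * (((eval x p : ℝ) : ℂ) * gaussianWave y x) := by
    simp only [map_mul, eval_X, Complex.ofReal_mul]
    ring
  have h := integral_bilinear_hasLineDerivAt_right_eq_neg_left_of_integrable (μ := volume)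
    (B := ContinuousLinearMap.mul ℝ ℂ) (v := EuclideanSpace.single j (1 : ℝ))
    (f := fun x : EuclideanSpace ℝ (Fin n) => ((eval x p : ℝ) : ℂ))
    (f' := fun x => ((eval x (pderiv j p) : ℝ) : ℂ)) (g := gaussianWave y)
    (g' := fun x => (-2 * (x j : ℂ) - Complex.I * (y j : ℂ)) * gaussianWave y x)
    (integrable_eval_mul_gaussianWave _ y)
    (by
      simp only [ContinuousLinearMap.mul_apply', hsplit]
      exact (hX.const_mul _).sub (hp.const_mul _))
    hp
    (fun x _ => HasDerivAt.ofReal_comp (p.hasLineDerivAt_eval_single j x))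
    (fun x _ => hasLineDerivAt_gaussianWave y x j)
  simp only [ContinuousLinearMap.mul_apply', hsplit] at h
  rw [integral_sub (hX.const_mul _) (hp.const_mul _), integral_const_mul, integral_const_mul] at h
  linear_combination (-1 / 2) * h

theorem integral_gaussianWave {n : ℕ} (y : EuclideanSpace ℝ (Fin n)) :
    ∫ x, gaussianWave y x =
      ((π ^ ((n : ℝ) / 2) : ℝ) : ℂ) * Complex.exp (-(‖y‖ : ℂ) ^ 2 / 4) := by
  have h := GaussianFourier.integral_cexp_neg_mul_sq_norm_add (b := 1) (by simp) (-Complex.I) y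
  convert! h using 2
  · ext x
    rw [gaussianWave, ← Complex.exp_add, real_inner_comm]
    ring_nf
  · rw [Complex.ofReal_cpow pi_nonneg]
    simp
  · simp

/-- Hecke's identity for harmonic homogeneous polynomials. -/
theorem MvPolynomial.IsHomogeneous.integral_eval_mul_gaussianWave {n d : ℕ}
    {p : MvPolynomial (Fin n) ℝ} (hp : p.IsHomogeneous d)
    (hharm : ∑ j, pderiv j (pderiv j p) = 0) (y : EuclideanSpace ℝ (Fin n)) :
    ∫ x : EuclideanSpace ℝ (Fin n), ((eval x p : ℝ) : ℂ) * gaussianWave y x =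
      (-Complex.I / 2) ^ d * ((eval y p : ℝ) : ℂ) * ∫ x, gaussianWave y x := by
  induction d generalizing p with
  | zero =>
    obtain ⟨c, rfl⟩ : ∃ c, p = C c :=
      ⟨_, totalDegree_eq_zero_iff_eq_C.mp (Nat.le_zero.mp hp.totalDegree_le)⟩
    simp [integral_const_mul]
  | succ d ih =>
    have hih (j : Fin n) := ih (p := pderiv j p) hp.pderiv (by
      rw [← map_zero (pderiv j), ← hharm, map_sum]
      simp only [pderiv_comm j])
    have heuler := hp.sum_X_mul_pderiv
    have heval (x : EuclideanSpace ℝ (Fin n)) : ((d + 1 : ℕ) : ℂ) * ((eval x p : ℝ) : ℂ) =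
        ∑ j, ((eval x (X j * pderiv j p) : ℝ) : ℂ) := by
      have := congrArg (fun q => ((eval x q : ℝ) : ℂ)) heuler
      simpa using this.symm
    have hlap : ∑ j, ∫ x : EuclideanSpace ℝ (Fin n),
        ((eval x (pderiv j (pderiv j p)) : ℝ) : ℂ) * gaussianWave y x = 0 := by
      rw [← integral_finsetSum _ fun j _ => integrable_eval_mul_gaussianWave _ y]
      simp only [← Finset.sum_mul, ← Complex.ofReal_sum, ← map_sum, hharm]
      simp
    have hd : ((d + 1 : ℕ) : ℂ) ≠ 0 := Nat.cast_ne_zero.mpr d.succ_ne_zero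
    apply mul_left_cancel₀ hd
    rw [← integral_const_mul]
    simp only [← mul_assoc, heval, Finset.sum_mul]
    rw [integral_finsetSum _ fun j _ => integrable_eval_mul_gaussianWave _ y]
    simp only [integral_eval_X_mul_gaussianWave, hih]
    rw [Finset.sum_sub_distrib, ← Finset.mul_sum, hlap, mul_zero, zero_sub, mul_right_comm,
      mul_right_comm, mul_right_comm (((d + 1 : ℕ) : ℂ)), heval, Finset.sum_mul, Finset.sum_mul,
      ← Finset.sum_neg_distrib]
    refine Finset.sum_congr rfl fun j _ => ?_
    simp only [map_mul, eval_X, Complex.ofReal_mul, pow_succ]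
    ring

/-- Hecke's identity: for a harmonic product of linear forms `P(λ) = ∏ᵢ ⟪αᵢ, λ⟫` of degree
`d`, `∫_{ℝⁿ} e^{−‖λ‖²} P(λ) e^{−i⟨λ,y⟩} dλ = (−i)^d 2^{−d} π^{n/2} P(y) e^{−‖y‖²/4}`. -/
theorem hecke_identity (n d : ℕ) (hn : 1 ≤ n)
    (α : Fin d → EuclideanSpace ℝ (Fin n))
    (P : EuclideanSpace ℝ (Fin n) → ℝ)
    (hP : ∀ lam, P lam = ∏ i : Fin d, ⟪α i, lam⟫)
    (hharm : ∀ lam, laplacian P lam = 0)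
    (y : EuclideanSpace ℝ (Fin n)) :
    ∫ lam : EuclideanSpace ℝ (Fin n),
        Complex.exp (-(‖lam‖ : ℂ) ^ 2) * (P lam : ℂ) *
          Complex.exp (-(Complex.I * (⟪lam, y⟫ : ℝ))) =
      (-Complex.I) ^ d * (2 : ℂ) ^ (-(d : ℤ)) * ((π ^ ((n : ℝ) / 2) : ℝ) : ℂ) * (P y : ℂ) *
        Complex.exp (-(‖y‖ : ℂ) ^ 2 / 4) := by
  obtain ⟨p, hp, hPp⟩ : ∃ p : MvPolynomial (Fin n) ℝ, p.IsHomogeneous d ∧ ∀ x, P x = eval x p := by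
    refine ⟨∏ i, ∑ j, C (α i j) * X j, ?_, fun x => ?_⟩
    · have h := IsHomogeneous.prod Finset.univ
        (fun i => ∑ j, C (α i j) * X j : Fin d → MvPolynomial (Fin n) ℝ) (fun _ => 1)
        fun i _ => IsHomogeneous.sum _ _ _ fun j _ => isHomogeneous_C_mul_X _ _
      simpa using h
    · simp [hP, map_prod, PiLp.inner_apply, mul_comm]
  obtain rfl : P = fun x : EuclideanSpace ℝ (Fin n) => eval x p := funext hPp
  have hlap : ∑ j, pderiv j (pderiv j p) = 0 := by
    refine MvPolynomial.funext fun x => ?_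
    rw [map_zero, ← hharm (WithLp.toLp 2 x), laplacian_eval]
  have h := hp.integral_eval_mul_gaussianWave hlap y
  rw [integral_gaussianWave] at h
  calc _ = ∫ x : EuclideanSpace ℝ (Fin n), ((eval x p : ℝ) : ℂ) * gaussianWave y x := by
        congr 1 with x
        rw [gaussianWave]
        ring
    _ = _ := by
        rw [h, div_pow, zpow_neg, zpow_natCast]
        ring
end
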